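/- arXiv:1007.0450 — 11 statements merged into one kernel-verified Lean document; each statement's English description precedes it below -/
import Mathlib

section
/- Let n ≥ 1 and let A be a real n×n matrix such that I − AᵀA is positive definite. Then det(I + A) + det(I − A) ≥ 2·√(det(I − AᵀA)), and equality holds if and only if A is symmetric and det(I + A) = det(I − A). -/
open Matrix

open scoped MatrixOrder

theorem Finset.one_add_sum_le_prod_one_add_of_nonneg {ι : Type*} (s : Finset ι) {f : ι → ℝ}
    (hf : ∀ i ∈ s, 0 ≤ f i) : 1 + ∑ i ∈ s, f i ≤ ∏ i ∈ s, (1 + f i) := by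
  classical
  induction s using Finset.induction_on with
  | empty => simp
  | insert a s ha ih =>
    have hs : ∀ i ∈ s, 0 ≤ f i := fun i hi => hf i (Finset.mem_insert_of_mem hi)
    have hfa := hf a (Finset.mem_insert_self a s)
    rw [Finset.sum_insert ha, Finset.prod_insert ha]
    nlinarith [ih hs, mul_nonneg hfa (Finset.sum_nonneg hs)]

namespace Matrix

variable {m : Type*} [Fintype m] [DecidableEq m]

theorem IsHermitian.det_one_add {X : Matrix m m ℝ} (hX : X.IsHermitian) :
    (1 + X).det = ∏ i, (1 + hX.eigenvalues i) := by
  have h := X.eval_charpoly (-1)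
  have hneg : Matrix.scalar m (-1 : ℝ) - X = -(1 + X) := by
    rw [map_neg, map_one]; abel
  have hprod : ∏ i, (-1 - hX.eigenvalues i) = ∏ i, -(1 + hX.eigenvalues i) :=
    Finset.prod_congr rfl fun i _ => by ring
  rw [hneg, det_neg, hX.charpoly_eq, Polynomial.eval_prod] at h
  simp only [Polynomial.eval_sub, Polynomial.eval_X, Polynomial.eval_C, RCLike.ofReal_real_eq_id,
    id_eq] at h
  rw [hprod, Finset.prod_neg, Finset.card_univ] at h
  exact (mul_left_cancel₀ (pow_ne_zero _ (by norm_num)) h).symm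

theorem PosSemidef.one_add_trace_le_det_one_add {X : Matrix m m ℝ} (hX : X.PosSemidef) :
    1 + X.trace ≤ (1 + X).det := by
  rw [hX.1.det_one_add, hX.1.trace_eq_sum_eigenvalues]
  exact Finset.one_add_sum_le_prod_one_add_of_nonneg _ fun i _ => hX.eigenvalues_nonneg i

theorem det_one_add_sq_of_transpose_eq_neg {K : Matrix m m ℝ} (hK : Kᵀ = -K) :
    (1 + K).det ^ 2 = (1 + Kᵀ * K).det := by
  have h : (1 + K)ᵀ * (1 + K) = 1 + Kᵀ * K := by
    rw [transpose_add, transpose_one, hK]; noncomm_ring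
  rw [← h, det_mul, det_transpose, sq]

theorem one_add_trace_le_det_one_add_sq {K : Matrix m m ℝ} (hK : Kᵀ = -K) :
    1 + (Kᵀ * K).trace ≤ (1 + K).det ^ 2 := by
  rw [det_one_add_sq_of_transpose_eq_neg hK]
  exact (posSemidef_conjTranspose_mul_self K).one_add_trace_le_det_one_add

/-- Adding a skew-symmetric matrix to a positive definite one does not decrease the absolute
value of the determinant, and strictly increases it unless the skew-symmetric matrix vanishes. -/
theorem PosDef.det_sq_le_det_add_sq {S K : Matrix m m ℝ} (hS : S.PosDef) (hK : Kᵀ = -K) :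
    S.det ^ 2 ≤ (S + K).det ^ 2 ∧ ((S + K).det = S.det → K = 0) := by
  have hdet := hS.det_pos
  obtain ⟨B, rfl⟩ := CStarAlgebra.nonneg_iff_eq_star_mul_self.mp hS.posSemidef.nonneg
  rw [star_eq_conjTranspose, conjTranspose_eq_transpose_of_trivial] at *
  have hB : IsUnit B.det := by
    rw [det_mul] at hdet
    exact (right_ne_zero_of_mul hdet.ne').isUnit
  have hBt : IsUnit Bᵀ.det := by rwa [det_transpose]
  set L := Bᵀ⁻¹ * K * B⁻¹ with hL
  have hKL : Bᵀ * L * B = K := by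
    rw [hL, mul_assoc, mul_assoc, nonsing_inv_mul _ hB, mul_one,
      mul_nonsing_inv_cancel_left _ _ hBt]
  have hLskew : Lᵀ = -L := by
    rw [hL, transpose_mul, transpose_mul, hK, transpose_nonsing_inv, transpose_nonsing_inv,
      transpose_transpose]
    noncomm_ring
  have hfac : (Bᵀ * B + K).det = (Bᵀ * B).det * (1 + L).det := by
    have : Bᵀ * B + K = Bᵀ * (1 + L) * B := by rw [← hKL]; noncomm_ring
    rw [this, det_mul, det_mul, det_mul]; ring
  have htr : 0 ≤ (Lᵀ * L).trace := (posSemidef_conjTranspose_mul_self L).trace_nonneg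
  have hle := one_add_trace_le_det_one_add_sq hLskew
  refine ⟨?_, fun h => ?_⟩
  · rw [hfac, mul_pow]
    exact le_mul_of_one_le_right (sq_nonneg _) (by linarith)
  · rw [hfac] at h
    rw [(mul_eq_left₀ hdet.ne').mp h] at hle
    have hL0 : L = 0 := trace_conjTranspose_mul_self_eq_zero_iff.mp
      (by rw [conjTranspose_eq_transpose_of_trivial]; linarith)
    rw [← hKL, hL0, mul_zero, zero_mul]

theorem det_one_add_smul_ne_zero {A : Matrix m m ℝ} (hA : (1 - Aᵀ * A).PosDef) {t : ℝ}
    (ht : t ^ 2 ≤ 1) : (1 + t • A).det ≠ 0 := by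
  intro h
  obtain ⟨v, hv, hv0⟩ := exists_mulVec_eq_zero_iff.mpr h
  have hpos := hA.dotProduct_mulVec_pos hv
  have hvA : v = -(t • (A *ᵥ v)) := by
    rw [add_mulVec, one_mulVec, smul_mulVec] at hv0
    exact eq_neg_of_add_eq_zero_left hv0
  have hvv : v ⬝ᵥ v = t ^ 2 * (A *ᵥ v ⬝ᵥ A *ᵥ v) := by
    conv_lhs => rw [hvA]
    simp only [neg_dotProduct_neg, smul_dotProduct, dotProduct_smul, smul_eq_mul]
    ring
  have hform : v ⬝ᵥ (Aᵀ * A) *ᵥ v = A *ᵥ v ⬝ᵥ A *ᵥ v := by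
    rw [← mulVec_mulVec, dotProduct_mulVec, vecMul_transpose]
  rw [star_trivial, sub_mulVec, one_mulVec, dotProduct_sub, hform, hvv] at hpos
  have hnn : 0 ≤ A *ᵥ v ⬝ᵥ A *ᵥ v := Finset.sum_nonneg fun i _ => mul_self_nonneg _
  nlinarith

theorem det_one_add_pos {A : Matrix m m ℝ} (hA : (1 - Aᵀ * A).PosDef) : 0 < (1 + A).det := by
  by_contra! hneg
  have hcont : ContinuousOn (fun t : ℝ => (1 + t • A).det) (Set.Icc 0 1) := by fun_prop
  obtain ⟨t, ht, h0⟩ := intermediate_value_Icc' zero_le_one hcont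
    (show (0 : ℝ) ∈ _ by simpa using hneg)
  exact det_one_add_smul_ne_zero hA (by nlinarith [ht.1, ht.2]) h0

end Matrix

/-- **Mealy's inequality in graph coordinates** (Theorem 4.4 of Harvey–Lawson,
"Split Special Lagrangian Geometry").  If the graph `{(x, Ax)}` is space-like for the
split inner product, i.e. `I - AᵀA` is positive definite, then
`det(I + A) + det(I - A) ≥ 2 √(det(I - AᵀA))`, with equality iff `A` is symmetric and
`det(I + A) = det(I - A)`. -/
theorem mealy_inequality_graph_coordinates (n : ℕ) (hn : 1 ≤ n)
    (A : Matrix (Fin n) (Fin n) ℝ) (hA : (1 - Aᵀ * A).PosDef) :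
    2 * Real.sqrt (1 - Aᵀ * A).det ≤ (1 + A).det + (1 - A).det ∧
      ((1 + A).det + (1 - A).det = 2 * Real.sqrt (1 - Aᵀ * A).det ↔
        A.IsSymm ∧ (1 + A).det = (1 - A).det) := by
  have hP := det_one_add_pos hA
  have hQ : 0 < (1 - A).det := by
    have := det_one_add_pos (A := -A) (by simpa using hA)
    rwa [← sub_eq_add_neg] at this
  have hS := hA.det_pos
  have hK : (Aᵀ - A)ᵀ = -(Aᵀ - A) := by simp
  obtain ⟨hle, heq⟩ := hA.det_sq_le_det_add_sq hK
  have hfac : (1 - Aᵀ * A + (Aᵀ - A)).det = (1 + A).det * (1 - A).det := by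
    rw [← det_transpose (1 + A), ← det_mul, transpose_add, transpose_one]
    congr 1
    noncomm_ring
  rw [hfac] at hle heq
  have hprod : (1 - Aᵀ * A).det ≤ (1 + A).det * (1 - A).det :=
    (sq_le_sq₀ hS.le (mul_pos hP hQ).le).mp hle
  have hr := Real.sq_sqrt hS.le
  have hr0 := Real.sqrt_nonneg (1 - Aᵀ * A).det
  refine ⟨?_, fun h => ?_, fun ⟨hsymm, hPQ⟩ => ?_⟩
  · refine (sq_le_sq₀ (by linarith) (by linarith)).mp ?_
    nlinarith [sq_nonneg ((1 + A).det - (1 - A).det)]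
  · have hsq : ((1 + A).det + (1 - A).det) ^ 2 = 4 * (1 - Aᵀ * A).det := by
      rw [h, mul_pow, hr]; norm_num
    have hdiff : ((1 + A).det - (1 - A).det) ^ 2 = 0 :=
      le_antisymm (by nlinarith) (sq_nonneg _)
    refine ⟨sub_eq_zero.mp (heq ?_), sub_eq_zero.mp (pow_eq_zero_iff two_ne_zero |>.mp hdiff)⟩
    nlinarith
  · rw [hsymm.eq, sub_self, add_zero, hPQ] at hfac
    rw [hsymm.eq, hfac, Real.sqrt_mul_self hQ.le, hPQ, two_mul]
end

section
/- Let n ≥ 1 and let B be a real n×n matrix such that B + Bᵀ is positive definite. Then 1 + det B ≥ 2·√(det(½(B + Bᵀ))), and equality holds if and only if B is symmetric and det B = 1. -/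
open Matrix

namespace Matrix

variable {n : Type*} [Fintype n] [DecidableEq n]

theorem PosSemidef.one_add_trace_le_det_one_add_s1 {A : Matrix n n ℝ} (hA : A.PosSemidef) :
    1 + A.trace ≤ (1 + A).det := by
  have hdet : (1 + A).det = ∏ i, (1 + hA.1.eigenvalues i) := by
    have h := congrArg (Polynomial.eval (-1)) hA.1.charpoly_eq
    have hneg : scalar n (-1 : ℝ) - A = -(1 + A) := by
      rw [map_neg, map_one]; abel
    have hprod : ∏ i, (-1 - hA.1.eigenvalues i) =
        (-1) ^ Fintype.card n * ∏ i, (1 + hA.1.eigenvalues i) := by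
      rw [← Finset.card_univ, ← Finset.prod_const, ← Finset.prod_mul_distrib]
      exact Finset.prod_congr rfl fun i _ => by ring
    rw [eval_charpoly, hneg, det_neg, Polynomial.eval_prod] at h
    simp only [Polynomial.eval_sub, Polynomial.eval_X, Polynomial.eval_C, RCLike.ofReal_real_eq_id,
      id, hprod] at h
    exact mul_left_cancel₀ (pow_ne_zero _ (by norm_num)) h
  have htrace : A.trace = ∑ i, hA.1.eigenvalues i := by
    simpa using hA.1.trace_eq_sum_eigenvalues
  rw [hdet, htrace]
  have key (s : Finset n) :
      1 + ∑ i ∈ s, hA.1.eigenvalues i ≤ ∏ i ∈ s, (1 + hA.1.eigenvalues i) := by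
    induction s using Finset.induction_on with
    | empty => simp
    | insert a s ha ih =>
      rw [Finset.sum_insert ha, Finset.prod_insert ha]
      have h₁ := hA.eigenvalues_nonneg a
      have h₂ : 0 ≤ ∑ i ∈ s, hA.1.eigenvalues i :=
        Finset.sum_nonneg fun i _ => hA.eigenvalues_nonneg i
      nlinarith
  exact key Finset.univ

theorem one_add_trace_le_sq_det_one_add_of_skew {K : Matrix n n ℝ} (hK : Kᵀ = -K) :
    1 + (Kᴴ * K).trace ≤ (1 + K).det ^ 2 := by
  refine (posSemidef_conjTranspose_mul_self K).one_add_trace_le_det_one_add_s1.trans_eq ?_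
  have h : 1 + Kᴴ * K = (1 + K)ᵀ * (1 + K) := by
    rw [conjTranspose_eq_transpose_of_trivial, transpose_add, transpose_one, hK]
    noncomm_ring
  rw [h, det_mul, det_transpose, sq]

theorem one_le_sq_det_one_add_of_skew {K : Matrix n n ℝ} (hK : Kᵀ = -K) :
    1 ≤ (1 + K).det ^ 2 := by
  have h := one_add_trace_le_sq_det_one_add_of_skew hK
  have := (posSemidef_conjTranspose_mul_self K).trace_nonneg
  linarith

theorem one_le_det_one_add_of_skew {K : Matrix n n ℝ} (hK : Kᵀ = -K) : 1 ≤ (1 + K).det := by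
  have hsq (t : ℝ) : 1 ≤ (1 + t • K).det ^ 2 :=
    one_le_sq_det_one_add_of_skew (by rw [transpose_smul, hK, smul_neg])
  have hcont : Continuous fun t : ℝ => (1 + t • K).det := by fun_prop
  by_contra! hlt
  have h₁ := one_le_sq_det_one_add_of_skew hK
  obtain ⟨t, -, ht⟩ := intermediate_value_Icc' zero_le_one hcont.continuousOn
    (show (0 : ℝ) ∈ Set.Icc (1 + (1 : ℝ) • K).det (1 + (0 : ℝ) • K).det by
      simp only [one_smul, zero_smul, add_zero, det_one]
      exact ⟨by nlinarith, zero_le_one⟩)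
  have := hsq t
  simp only at ht
  rw [ht] at this
  norm_num at this

theorem eq_zero_of_skew_of_det_one_add_eq_one {K : Matrix n n ℝ} (hK : Kᵀ = -K)
    (hdet : (1 + K).det = 1) : K = 0 := by
  have h := one_add_trace_le_sq_det_one_add_of_skew hK
  have := (posSemidef_conjTranspose_mul_self K).trace_nonneg
  rw [← trace_conjTranspose_mul_self_eq_zero_iff]
  rw [hdet] at h
  linarith

open scoped MatrixOrder Matrix.Norms.L2Operator in
theorem PosDef.exists_isUnit_eq_transpose_mul_self {S : Matrix n n ℝ} (hS : S.PosDef) :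
    ∃ P : Matrix n n ℝ, IsUnit P ∧ S = Pᵀ * P := by
  obtain ⟨P, hP, h⟩ := CStarAlgebra.isStrictlyPositive_iff_eq_star_mul_self.mp
    (isStrictlyPositive_iff_posDef.mpr hS)
  exact ⟨P, hP, by simpa [star_eq_conjTranspose] using h⟩

/-- **Ostrowski–Taussky inequality**, with its equality case: adding a skew-symmetric matrix to a
positive definite one does not decrease the determinant. -/
theorem PosDef.det_le_det_add_of_skew {S K : Matrix n n ℝ} (hS : S.PosDef) (hK : Kᵀ = -K) :
    S.det ≤ (S + K).det ∧ ((S + K).det = S.det → K = 0) := by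
  obtain ⟨P, hP, rfl⟩ := hS.exists_isUnit_eq_transpose_mul_self
  have hPdet : IsUnit P.det := (isUnit_iff_isUnit_det P).mp hP
  have hPTdet : IsUnit Pᵀ.det := by rwa [det_transpose]
  set L := Pᵀ⁻¹ * K * P⁻¹ with hL
  have hLskew : Lᵀ = -L := by
    rw [hL, transpose_mul, transpose_mul, hK, transpose_nonsing_inv, transpose_nonsing_inv,
      transpose_transpose]
    noncomm_ring
  have hKL : K = Pᵀ * L * P := by
    rw [hL, ← mul_assoc, ← mul_assoc, mul_nonsing_inv _ hPTdet, one_mul, mul_assoc,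
      nonsing_inv_mul _ hPdet, mul_one]
  have hdet : (Pᵀ * P + K).det = (Pᵀ * P).det * (1 + L).det := by
    have h : Pᵀ * P + K = Pᵀ * (1 + L) * P := by
      rw [hKL]; noncomm_ring
    rw [h, det_mul, det_mul, det_mul]
    ring
  have hpos := hS.det_pos
  have hone := one_le_det_one_add_of_skew hLskew
  refine ⟨by rw [hdet]; nlinarith, fun h => ?_⟩
  rw [hdet, mul_eq_left₀ hpos.ne'] at h
  rw [hKL, eq_zero_of_skew_of_det_one_add_eq_one hLskew h, mul_zero, zero_mul]

end Matrix

/-- **Mealy's inequality in null coordinates** (Theorem 4.4 of Harvey–Lawson,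
"Split Special Lagrangian Geometry").  If the graph `{(u, Bu)}` in null coordinates is
space-like, i.e. `B + Bᵀ` is positive definite, then
`1 + det B ≥ 2 √(det(½(B + Bᵀ)))`, with equality iff `B` is symmetric and `det B = 1`. -/
theorem mealy_inequality_null_coordinates (n : ℕ) (hn : 1 ≤ n)
    (B : Matrix (Fin n) (Fin n) ℝ) (hB : (B + Bᵀ).PosDef) :
    2 * Real.sqrt (((1 / 2 : ℝ) • (B + Bᵀ)).det) ≤ 1 + B.det ∧
      (1 + B.det = 2 * Real.sqrt (((1 / 2 : ℝ) • (B + Bᵀ)).det) ↔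
        B.IsSymm ∧ B.det = 1) := by
  set S := (1 / 2 : ℝ) • (B + Bᵀ) with hSdef
  set K := (1 / 2 : ℝ) • (B - Bᵀ) with hKdef
  have hS : S.PosDef := hB.smul (by norm_num)
  have hK : Kᵀ = -K := by
    rw [hKdef, transpose_smul, transpose_sub, transpose_transpose, ← smul_neg, neg_sub]
  have hSK : S + K = B := by
    rw [hSdef, hKdef]
    module
  obtain ⟨hle, heq⟩ := hS.det_le_det_add_of_skew hK
  rw [hSK] at hle heq
  have hsqrt := Real.sq_sqrt hS.det_pos.le
  have hsq := sq_nonneg (√S.det - 1)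
  refine ⟨by nlinarith, fun h => ?_, fun ⟨hsymm, hdet⟩ => ?_⟩
  · have hroot : √S.det = 1 := by
      have : (√S.det - 1) ^ 2 = 0 := by nlinarith
      linarith [pow_eq_zero_iff two_ne_zero |>.mp this]
    rw [hroot] at h hsqrt
    have hK0 := heq (by linarith)
    rw [hK0, add_zero] at hSK
    refine ⟨?_, by linarith⟩
    rw [← hSK]
    simpa using hS.isHermitian
  · have : S = B := by
      rw [hSdef, hsymm.eq]
      module
    rw [this, hdet, Real.sqrt_one]
    norm_num
end

section
/- Let Ω ⊆ ℝ^n be open and f : Ω → ℝ be C². For x ∈ Ω let H(x) = Hess f(x) denote the (symmetric) Hessian matrix. Then the graph M = {(x, ∇f(x)) : x ∈ Ω} ⊆ ℝ^n × ℝ^n is split special Lagrangian — i.e. at every x ∈ Ω the tangent space {(v, H(x)v) : v ∈ ℝ^n} is space-like for the split form and the n-form Im dz vanishes on it — if and only if for every x ∈ Ω one has −I < H(x) < I (in the Loewner order) and ∑_{k odd, 1 ≤ k ≤ n} σ_k(H(x)) = 0, where σ_k(H) denotes the sum of all principal k×k minors of H. -/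
open Matrix

/-- The sum of the principal `k × k` minors of a square matrix
(the `k`-th elementary symmetric function `σ_k` of the matrix). -/
noncomputable def principalMinorSum {n : ℕ} (A : Matrix (Fin n) (Fin n) ℝ) (k : ℕ) : ℝ :=
  ∑ s ∈ Finset.univ.powersetCard k,
    (A.submatrix (fun i : {x : Fin n // x ∈ s} => (i : Fin n))
      (fun j : {x : Fin n // x ∈ s} => (j : Fin n))).det

/-- The alternating `n`-form `Im dz` on `D^n = ℝ^n × ℝ^n`:
`(Im dz)(w₁,…,w_n) = ½[det(x₁+y₁ | … | x_n+y_n) − det(x₁−y₁ | … | x_n−y_n)]`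
for `w_i = (x_i, y_i)`. -/
noncomputable def imDz {n : ℕ} (w : Fin n → (Fin n → ℝ) × (Fin n → ℝ)) : ℝ :=
  (1 / 2) * ((Matrix.of fun i j : Fin n => (w j).1 i + (w j).2 i).det -
    (Matrix.of fun i j : Fin n => (w j).1 i - (w j).2 i).det)

open Polynomial in
theorem eval_det_one_add_X_smul {n R : Type*} [Fintype n] [DecidableEq n] [CommRing R]
    (A : Matrix n n R) (t : R) :
    (det (1 + (X : R[X]) • A.map C)).eval t = (1 + t • A).det := by
  rw [← coe_evalRingHom, RingHom.map_det]
  congr 1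
  ext i j
  by_cases h : i = j <;> simp [h, mul_comm t]

open Polynomial in
theorem det_one_add_smul_eq_sum_principalMinorSum {n : ℕ} (A : Matrix (Fin n) (Fin n) ℝ) (t : ℝ) :
    (1 + t • A).det = ∑ k ∈ Finset.range (n + 1), principalMinorSum A k * t ^ k := by
  have hdeg : (det (1 + (X : ℝ[X]) • A.map C)).natDegree < n + 1 := by
    have h := natDegree_det_X_add_C_le A 1
    rw [Matrix.map_one C C_0 C_1, add_comm, Fintype.card_fin] at h
    exact Nat.lt_succ_of_le h
  rw [← eval_det_one_add_X_smul, eval_eq_sum_range' hdeg]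
  simp_rw [coeff_det_one_add_X_smul_eq_sum_minors]
  rfl

theorem det_one_add_sub_det_one_sub {n : ℕ} (A : Matrix (Fin n) (Fin n) ℝ) :
    (1 + A).det - (1 - A).det =
      2 * ∑ k ∈ (Finset.range (n + 1)).filter (fun k => Odd k), principalMinorSum A k := by
  have hadd := det_one_add_smul_eq_sum_principalMinorSum A 1
  have hsub := det_one_add_smul_eq_sum_principalMinorSum A (-1)
  rw [one_smul] at hadd
  rw [neg_one_smul, ← sub_eq_add_neg] at hsub
  rw [hadd, hsub, ← Finset.sum_sub_distrib, Finset.sum_filter, Finset.mul_sum]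
  refine Finset.sum_congr rfl fun k _ => ?_
  rcases Nat.even_or_odd k with h | h
  · simp [h.neg_one_pow, Nat.not_odd_iff_even.mpr h]
  · simp only [one_pow, h.neg_one_pow, h, if_true]
    ring

theorem imDz_graph {n : ℕ} (A : Matrix (Fin n) (Fin n) ℝ) (w : Fin n → Fin n → ℝ) :
    imDz (fun i => (w i, A.mulVec (w i))) =
      (∑ k ∈ (Finset.range (n + 1)).filter (fun k => Odd k), principalMinorSum A k) *
        (Matrix.of w).det := by
  have hadd : (Matrix.of fun i j : Fin n => w j i + A.mulVec (w j) i) =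
      (1 + A) * (Matrix.of w)ᵀ := by
    ext i j
    rw [add_mul, one_mul, Matrix.add_apply, Matrix.mul_apply]
    rfl
  have hsub : (Matrix.of fun i j : Fin n => w j i - A.mulVec (w j) i) =
      (1 - A) * (Matrix.of w)ᵀ := by
    ext i j
    rw [sub_mul, one_mul, Matrix.sub_apply, Matrix.mul_apply]
    rfl
  have h := det_one_add_sub_det_one_sub A
  simp only [imDz]
  rw [hadd, hsub, det_mul, det_mul, det_transpose, ← sub_mul, h]
  ring

theorem imDz_graph_eq_zero_iff {n : ℕ} (A : Matrix (Fin n) (Fin n) ℝ) :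
    (∀ w : Fin n → Fin n → ℝ, imDz (fun i => (w i, A.mulVec (w i))) = 0) ↔
      ∑ k ∈ (Finset.range (n + 1)).filter (fun k => Odd k), principalMinorSum A k = 0 := by
  simp only [imDz_graph]
  refine ⟨fun h => ?_, fun h w => by rw [h, zero_mul]⟩
  have h1 := h (1 : Matrix (Fin n) (Fin n) ℝ)
  change _ * (1 : Matrix (Fin n) (Fin n) ℝ).det = 0 at h1
  rwa [det_one, mul_one] at h1

theorem spaceLike_graph_iff {n : Type*} [Fintype n] [DecidableEq n] {A : Matrix n n ℝ}
    (hA : A.IsSymm) :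
    (∀ v : n → ℝ, v ≠ 0 → 0 < v ⬝ᵥ v - A.mulVec v ⬝ᵥ A.mulVec v) ↔
      (1 + A).PosDef ∧ (1 - A).PosDef := by
  have hherm : A.IsHermitian := by rwa [IsHermitian, conjTranspose_eq_transpose_of_trivial]
  constructor
  · intro h
    refine ⟨.of_dotProduct_mulVec_pos (isHermitian_one.add hherm) fun v hv => ?_,
      .of_dotProduct_mulVec_pos (isHermitian_one.sub hherm) fun v hv => ?_⟩
    · have hsq : 0 ≤ (v + A.mulVec v) ⬝ᵥ (v + A.mulVec v) := by
        simpa using dotProduct_star_self_nonneg (v + A.mulVec v)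
      have hcomm := dotProduct_comm (A.mulVec v) v
      have hpos := h v hv
      simp only [add_dotProduct, dotProduct_add] at hsq
      simp only [star_trivial, add_mulVec, one_mulVec, dotProduct_add]
      linarith
    · have hsq : 0 ≤ (v - A.mulVec v) ⬝ᵥ (v - A.mulVec v) := by
        simpa using dotProduct_star_self_nonneg (v - A.mulVec v)
      have hcomm := dotProduct_comm (A.mulVec v) v
      have hpos := h v hv
      simp only [sub_dotProduct, dotProduct_sub] at hsq
      simp only [star_trivial, sub_mulVec, one_mulVec, dotProduct_sub]
      linarith
  · rintro ⟨hp, hm⟩ v hv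
    have hp0 : (1 + A).mulVec v ≠ 0 := fun h0 => by
      simpa [h0] using hp.dotProduct_mulVec_pos hv
    have hm0 : (1 - A).mulVec v ≠ 0 := fun h0 => by
      simpa [h0] using hm.dotProduct_mulVec_pos hv
    have h1 := hm.dotProduct_mulVec_pos hp0
    have h2 := hp.dotProduct_mulVec_pos hm0
    have hself (x y : n → ℝ) : A.mulVec x ⬝ᵥ y = x ⬝ᵥ A.mulVec y := by
      rw [dotProduct_mulVec, ← mulVec_transpose, hA.eq]
    simp only [star_trivial, add_mulVec, sub_mulVec, one_mulVec, add_dotProduct, dotProduct_add,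
      sub_dotProduct, dotProduct_sub, mulVec_add, mulVec_sub, hself] at h1 h2 ⊢
    linarith

theorem hessian_isSymm {n : ℕ} {Ω : Set (Fin n → ℝ)} (hΩ : IsOpen Ω)
    {f : (Fin n → ℝ) → ℝ} {g : (Fin n → ℝ) → (Fin n → ℝ)} {A : Matrix (Fin n) (Fin n) ℝ}
    (hg : ∀ x ∈ Ω, HasFDerivAt f
      (∑ i : Fin n, g x i • (ContinuousLinearMap.proj i : (Fin n → ℝ) →L[ℝ] ℝ)) x)
    {x : Fin n → ℝ} (hx : x ∈ Ω)
    (hA : HasFDerivAt g (LinearMap.toContinuousLinearMap (Matrix.mulVecLin A)) x) :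
    A.IsSymm := by
  have hcoord (i : Fin n) := hasFDerivAt_pi'.mp hA i
  have hderiv := HasFDerivAt.fun_sum (u := Finset.univ) fun i _ =>
    (hcoord i).smul_const (ContinuousLinearMap.proj i : (Fin n → ℝ) →L[ℝ] ℝ)
  have hsymm := second_derivative_symmetric_of_eventually
    (Filter.eventually_of_mem (hΩ.mem_nhds hx) hg) hderiv
  ext i j
  simpa [Pi.single_apply] using hsymm (Pi.single i 1) (Pi.single j 1)

/-- **Mealy's Theorem 6.1** (Harvey–Lawson, "Split Special Lagrangian Geometry"):
let `f` be `C²` on an open set `Ω ⊆ ℝ^n`, with gradient `g` and Hessian matrix `H`.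
Then the graph `{(x, ∇f(x))} ⊆ ℝ^n × ℝ^n = D^n` is split special Lagrangian — at every
`x ∈ Ω` the tangent space `{(v, H(x)v)}` is space-like for the split form and `Im dz`
vanishes on it — if and only if `−I < H(x) < I` (Loewner order) and
`Σ_{k odd, 1 ≤ k ≤ n} σ_k(H(x)) = 0` for every `x ∈ Ω`. -/
theorem slag_gradient_graph_equation (n : ℕ) (Ω : Set (Fin n → ℝ)) (hΩ : IsOpen Ω)
    (f : (Fin n → ℝ) → ℝ) (g : (Fin n → ℝ) → (Fin n → ℝ))
    (H : (Fin n → ℝ) → Matrix (Fin n) (Fin n) ℝ)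
    (hf : ContDiffOn ℝ 2 f Ω)
    (hg : ∀ x ∈ Ω, HasFDerivAt f
      (∑ i : Fin n, g x i • (ContinuousLinearMap.proj i : (Fin n → ℝ) →L[ℝ] ℝ)) x)
    (hH : ∀ x ∈ Ω, HasFDerivAt g
      (LinearMap.toContinuousLinearMap (Matrix.mulVecLin (H x))) x) :
    (∀ x ∈ Ω,
        (∀ v : Fin n → ℝ, v ≠ 0 →
          0 < v ⬝ᵥ v - (H x).mulVec v ⬝ᵥ (H x).mulVec v) ∧
        (∀ w : Fin n → Fin n → ℝ, imDz (fun i => (w i, (H x).mulVec (w i))) = 0)) ↔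
    (∀ x ∈ Ω, (1 + H x).PosDef ∧ (1 - H x).PosDef ∧
        ∑ k ∈ (Finset.range (n + 1)).filter (fun k => Odd k),
          principalMinorSum (H x) k = 0) := by
  refine forall₂_congr fun x hx => ?_
  rw [spaceLike_graph_iff (hessian_isSymm hΩ hg hx (hH x hx)), imDz_graph_eq_zero_iff, and_assoc]
end

section
/- Let P be an n-dimensional linear subspace of ℝ^n × ℝ^n (null coordinates (u,v) on D^n). Then the following are equivalent: (a) the quadratic form (u,v) ↦ u⋅v is positive definite on P, the form ω((u,v),(u',v')) = u⋅v' − v⋅u' vanishes identically on P, and for every n-tuple of vectors w₁ = (u₁,v₁),…,w_n = (u_n,v_n) in P one has det(u₁ | … | u_n) = det(v₁ | … | v_n); (b) there exists a symmetric positive definite real n×n matrix A with det A = 1 such that P = {(u, Au) : u ∈ ℝ^n}. -/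
open Matrix

/-- An `n`-dimensional subspace of `K^n × K^n` that meets `0 × K^n` trivially is the graph of
a matrix. -/
lemma Submodule.exists_matrix_graph {K : Type*} [Field K] {n : ℕ}
    (P : Submodule K ((Fin n → K) × (Fin n → K)))
    (hdim : Module.finrank K P = n) (hP : ∀ p ∈ P, p.1 = 0 → p = 0) :
    ∃ A : Matrix (Fin n) (Fin n) K, ∀ p : (Fin n → K) × (Fin n → K), p ∈ P ↔ p.2 = A *ᵥ p.1 := by
  let f : P →ₗ[K] (Fin n → K) := LinearMap.fst K _ _ ∘ₗ P.subtype
  have hf : Function.Injective f :=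
    (injective_iff_map_eq_zero f).2 fun p hp => Subtype.ext (hP p p.2 hp)
  let e : P ≃ₗ[K] (Fin n → K) := f.linearEquivOfInjective hf (by simp [hdim])
  have he : ∀ p : P, e p = p.1.1 := fun _ => rfl
  refine ⟨LinearMap.toMatrix' (LinearMap.snd K _ _ ∘ₗ P.subtype ∘ₗ e.symm.toLinearMap),
    fun p => ?_⟩
  rw [LinearMap.toMatrix'_mulVec]
  constructor
  · intro hp
    have h : e.symm p.1 = ⟨p, hp⟩ := e.symm_apply_eq.2 (he ⟨p, hp⟩).symm
    simp [h]
  · intro hp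
    have h : p = (e.symm p.1 : P) := by
      refine Prod.ext ?_ hp
      rw [← he, e.apply_symm_apply]
    rw [h]
    exact (e.symm p.1).2

/-- A matrix is symmetric if the associated bilinear form is. -/
lemma Matrix.IsSymm.of_dotProduct_mulVec {ι R : Type*} [Fintype ι] [DecidableEq ι] [CommRing R]
    {A : Matrix ι ι R} (h : ∀ x y, x ⬝ᵥ A *ᵥ y = A *ᵥ x ⬝ᵥ y) : A.IsSymm := by
  ext i j
  simpa using (h (Pi.single i 1) (Pi.single j 1)).symm

/-- **Proposition 6.4** of Harvey–Lawson, "Split Special Lagrangian Geometry":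
an `n`-dimensional plane `P ⊆ ℝ^n × ℝ^n` (null coordinates `(u,v)` on `D^n`) is split
special Lagrangian — i.e. the quadratic form `(u,v) ↦ u⋅v` is positive definite on `P`,
the symplectic form `ω((u,v),(u',v')) = u⋅v' − v⋅u'` vanishes on `P`, and
`det(u₁|…|u_n) = det(v₁|…|v_n)` for every `n`-tuple of vectors from `P` — if and only if
`P` is the graph of a symmetric positive definite matrix `A` with `det A = 1`. -/
theorem splitSLAG_null_graph_characterization (n : ℕ)
    (P : Submodule ℝ ((Fin n → ℝ) × (Fin n → ℝ)))
    (hdim : Module.finrank ℝ P = n) :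
    ((∀ p ∈ P, p ≠ 0 → 0 < p.1 ⬝ᵥ p.2) ∧
      (∀ p ∈ P, ∀ q ∈ P, p.1 ⬝ᵥ q.2 - p.2 ⬝ᵥ q.1 = 0) ∧
      (∀ w : Fin n → (Fin n → ℝ) × (Fin n → ℝ), (∀ i, w i ∈ P) →
        (Matrix.of fun i j : Fin n => (w j).1 i).det =
          (Matrix.of fun i j : Fin n => (w j).2 i).det)) ↔
    (∃ A : Matrix (Fin n) (Fin n) ℝ, A.IsSymm ∧ A.PosDef ∧ A.det = 1 ∧
      ∀ p : (Fin n → ℝ) × (Fin n → ℝ), p ∈ P ↔ p.2 = A.mulVec p.1) := by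
  constructor
  · rintro ⟨hpos, hlag, hdet⟩
    obtain ⟨A, hA⟩ := P.exists_matrix_graph hdim fun p hp h => by
      by_contra hne
      simpa [h] using hpos p hp hne
    have hmem : ∀ u, (u, A *ᵥ u) ∈ P := fun u => (hA _).2 rfl
    have hsymm : A.IsSymm := .of_dotProduct_mulVec fun x y =>
      sub_eq_zero.1 (hlag _ (hmem x) _ (hmem y))
    refine ⟨A, hsymm, .of_dotProduct_mulVec_pos ?_ fun x hx => ?_, ?_, hA⟩
    · simpa [IsHermitian, conjTranspose_eq_transpose_of_trivial] using hsymm.eq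
    · simpa using hpos _ (hmem x) fun h => hx (congrArg Prod.fst h)
    · have h := hdet (fun j => (Pi.single j 1, A *ᵥ Pi.single j 1)) fun j => hmem _
      have h₁ : (Matrix.of fun i j : Fin n => (Pi.single j 1 : Fin n → ℝ) i) = 1 := by
        ext i j
        simp [Pi.single_apply, one_apply]
      have h₂ : (Matrix.of fun i j : Fin n => (A *ᵥ Pi.single j 1) i) = A := by
        ext i j
        simp
      rw [h₁, h₂, det_one] at h
      exact h.symm
  · rintro ⟨A, hsymm, hpos, hdet, hA⟩
    refine ⟨fun p hp hne => ?_, fun p hp q hq => ?_, fun w hw => ?_⟩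
    · have hp' := (hA p).1 hp
      have hne' : p.1 ≠ 0 := fun h => hne (Prod.ext h (by simp [hp', h]))
      simpa [hp'] using hpos.dotProduct_mulVec_pos hne'
    · rw [(hA p).1 hp, (hA q).1 hq, dotProduct_mulVec, ← mulVec_transpose, hsymm.eq, sub_self]
    · have h : (Matrix.of fun i j : Fin n => (w j).2 i) =
          A * Matrix.of fun i j : Fin n => (w j).1 i := by
        ext i j
        simp [(hA _).1 (hw j), mul_apply, mulVec, dotProduct]
      rw [h, det_mul, hdet, one_mul]
end

section
/- Let Ω ⊆ ℝ^n be a bounded open set, let g : ℝ^n → ℝ be a C² function whose Hessian is positive definite with det Hess g(x) = 1 for every x in a neighborhood of the closure of Ω, and let H : ℝ^n → ℝ^n be a C¹ map such that {x : H(x) ≠ ∇g(x)} is contained in a compact subset of Ω and such that DH(x) + DH(x)ᵀ is positive definite for every x ∈ Ω. Then ∫_Ω √(det(½(DH(x) + DH(x)ᵀ))) dx ≤ vol(Ω), with equality if and only if DH(x) is symmetric and det DH(x) = 1 for every x ∈ Ω. -/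
open Matrix MeasureTheory

theorem Matrix.IsHermitian.det_one_add_eq_prod {n : Type*} [Fintype n] [DecidableEq n]
    {P : Matrix n n ℝ} (hP : P.IsHermitian) : (1 + P).det = ∏ i, (1 + hP.eigenvalues i) := by
  have h := congrArg (Polynomial.eval (-1)) hP.charpoly_eq
  rw [Matrix.eval_charpoly, Polynomial.eval_prod] at h
  have e1 : Matrix.scalar n (-1 : ℝ) - P = -(1 + P) := by
    rw [map_neg, map_one]; abel
  have e2 : ∀ i, Polynomial.eval (-1) (Polynomial.X - Polynomial.C (hP.eigenvalues i : ℝ)) =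
      (-1) * (1 + hP.eigenvalues i) := by
    intro i
    simp only [Polynomial.eval_sub, Polynomial.eval_X, Polynomial.eval_C]
    ring
  rw [e1, Matrix.det_neg] at h
  simp only [RCLike.ofReal_real_eq_id, id, e2, Finset.prod_mul_distrib, Finset.prod_const,
    Finset.card_univ] at h
  exact mul_left_cancel₀ (pow_ne_zero _ (by norm_num)) h

theorem Matrix.PosSemidef.one_le_det_one_add {n : Type*} [Fintype n] [DecidableEq n]
    {P : Matrix n n ℝ} (hP : P.PosSemidef) : 1 ≤ (1 + P).det := by
  rw [hP.1.det_one_add_eq_prod]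
  exact Finset.one_le_prod fun i _ => by linarith [hP.eigenvalues_nonneg i]

theorem Matrix.PosSemidef.eq_zero_of_det_one_add_eq_one {n : Type*} [Fintype n] [DecidableEq n]
    {P : Matrix n n ℝ} (hP : P.PosSemidef) (h : (1 + P).det = 1) : P = 0 := by
  rw [hP.1.det_one_add_eq_prod] at h
  rw [← hP.1.eigenvalues_eq_zero_iff]
  funext i
  rw [← Finset.mul_prod_erase _ _ (Finset.mem_univ i)] at h
  have hrest : 1 ≤ ∏ j ∈ Finset.univ.erase i, (1 + hP.1.eigenvalues j) :=
    Finset.one_le_prod fun j _ => by linarith [hP.eigenvalues_nonneg j]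
  have := hP.eigenvalues_nonneg i
  rw [Pi.zero_apply]
  nlinarith

theorem Matrix.det_ne_zero_of_posDef_add_transpose {n : Type*} [Fintype n] [DecidableEq n]
    {A : Matrix n n ℝ} (hA : (A + Aᵀ).PosDef) : A.det ≠ 0 := by
  intro h
  obtain ⟨v, hv, hAv⟩ := Matrix.exists_mulVec_eq_zero_iff.mpr h
  have := hA.dotProduct_mulVec_pos hv
  rw [Matrix.add_mulVec, hAv, zero_add, Matrix.mulVec_transpose, dotProduct_comm, star_trivial,
    ← Matrix.dotProduct_mulVec, hAv, dotProduct_zero] at this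
  exact lt_irrefl _ this

theorem Matrix.det_pos_of_posDef_add_transpose {n : Type*} [Fintype n] [DecidableEq n]
    {A : Matrix n n ℝ} (hA : (A + Aᵀ).PosDef) : 0 < A.det := by
  by_contra! hneg
  let f : ℝ → ℝ := fun t => ((1 - t) • (1 : Matrix n n ℝ) + t • A).det
  have hf : Continuous f := by fun_prop
  obtain ⟨t, ht, hft⟩ : (0 : ℝ) ∈ f '' Set.Icc 0 1 :=
    intermediate_value_Icc' zero_le_one hf.continuousOn ⟨by simpa [f] using hneg, by simp [f]⟩
  refine Matrix.det_ne_zero_of_posDef_add_transpose ?_ hft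
  have e : (1 - t) • (1 : Matrix n n ℝ) + t • A + ((1 - t) • (1 : Matrix n n ℝ) + t • A)ᵀ =
      (2 * (1 - t)) • (1 : Matrix n n ℝ) + t • (A + Aᵀ) := by
    rw [transpose_add, transpose_smul, transpose_smul, transpose_one]
    module
  rw [e]
  rcases eq_or_lt_of_le ht.1 with h0 | h0
  · subst h0
    simpa using Matrix.PosDef.one.smul (two_pos : (0 : ℝ) < 2)
  · exact Matrix.PosDef.posSemidef_add
      (Matrix.PosSemidef.one.smul (by linarith [ht.2] : (0 : ℝ) ≤ 2 * (1 - t))) (hA.smul h0)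

open scoped MatrixOrder in
/-- The determinant of a real matrix with positive definite symmetric part dominates the
determinant of that symmetric part, with equality only for symmetric matrices. -/
theorem Matrix.det_half_add_transpose_le_det {n : Type*} [Fintype n] [DecidableEq n]
    {A : Matrix n n ℝ} (hA : (A + Aᵀ).PosDef) :
    ((1 / 2 : ℝ) • (A + Aᵀ)).det ≤ A.det ∧
      (((1 / 2 : ℝ) • (A + Aᵀ)).det = A.det → A.IsSymm) := by
  have hdet := Matrix.det_pos_of_posDef_add_transpose hA
  set S : Matrix n n ℝ := (1 / 2 : ℝ) • (A + Aᵀ) with hS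
  have hSpos : S.PosDef := hA.smul (by norm_num : (0 : ℝ) < 1 / 2)
  obtain ⟨B, hB, hSB⟩ : ∃ B : Matrix n n ℝ, IsUnit B ∧ S = Bᵀ * B := by
    obtain ⟨B, hB⟩ := CStarAlgebra.nonneg_iff_eq_star_mul_self.mp hSpos.posSemidef.nonneg
    rw [star_eq_conjTranspose, conjTranspose_eq_transpose_of_trivial] at hB
    refine ⟨B, ?_, hB⟩
    have hne := hSpos.det_pos.ne'
    rw [hB, det_mul] at hne
    rw [Matrix.isUnit_iff_isUnit_det, isUnit_iff_ne_zero]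
    exact right_ne_zero_of_mul hne
  have hBdet : IsUnit B.det := (Matrix.isUnit_iff_isUnit_det B).mp hB
  set W : Matrix n n ℝ := (B⁻¹)ᵀ * (A - S) * B⁻¹ with hW
  have hskew : (A - S)ᵀ = -(A - S) := by
    rw [hS, transpose_sub, transpose_smul, transpose_add, transpose_transpose]
    module
  have hWskew : Wᵀ = -W := by
    rw [hW, transpose_mul, transpose_mul, hskew, transpose_transpose]
    rw [neg_mul, mul_neg, Matrix.mul_assoc]
  have hBB : Bᵀ * (B⁻¹)ᵀ = 1 := by
    rw [← transpose_mul, Matrix.nonsing_inv_mul _ hBdet, transpose_one]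
  have hWB : Bᵀ * W * B = A - S := by
    calc Bᵀ * W * B = (Bᵀ * (B⁻¹)ᵀ) * (A - S) * (B⁻¹ * B) := by
          rw [hW]; simp only [Matrix.mul_assoc]
      _ = A - S := by rw [hBB, Matrix.nonsing_inv_mul _ hBdet, one_mul, mul_one]
  have hAB : A = Bᵀ * (1 + W) * B := by
    rw [mul_add, add_mul, hWB, mul_one, ← hSB]; abel
  have hSdet : S.det = B.det ^ 2 := by
    rw [hSB, det_mul, det_transpose]; ring
  have hAdet : A.det = S.det * (1 + W).det := by
    rw [hSdet]
    conv_lhs => rw [hAB]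
    rw [det_mul, det_mul, det_transpose]; ring
  have hsq : (1 + W).det ^ 2 = (1 + Wᵀ * W).det := by
    have e : (1 + W)ᵀ * (1 + W) = 1 + Wᵀ * W := by
      rw [transpose_add, transpose_one, hWskew]; noncomm_ring
    rw [← e, det_mul, det_transpose]; ring
  have hP : (Wᵀ * W).PosSemidef := by
    simpa using Matrix.posSemidef_conjTranspose_mul_self W
  have hSd := hSpos.det_pos
  have hWpos : 0 < (1 + W).det := by
    rw [hAdet] at hdet
    exact (mul_pos_iff_of_pos_left hSd).mp hdet
  have h1 := hP.one_le_det_one_add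
  constructor
  · rw [hAdet]
    have : 1 ≤ (1 + W).det := by nlinarith
    nlinarith
  · intro h
    have hW1 : (1 + W).det = 1 := by
      rw [hAdet] at h
      exact mul_left_cancel₀ hSd.ne' (by rw [← h, mul_one])
    have h0 : Wᵀ * W = 0 := hP.eq_zero_of_det_one_add_eq_one (by rw [← hsq, hW1, one_pow])
    have hW0 : W = 0 := by
      rw [← conjTranspose_eq_transpose_of_trivial] at h0
      exact Matrix.conjTranspose_mul_self_eq_zero.mp h0
    rw [hW0, mul_zero, zero_mul] at hWB
    rw [sub_eq_zero.mp hWB.symm]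
    exact hSpos.1

theorem ContinuousLinearMap.det_smul_id_add_pos {E : Type*} [NormedAddCommGroup E]
    [NormedSpace ℝ E] [FiniteDimensional ℝ E] (A : E →L[ℝ] E) {c : ℝ} (hc : ‖A‖ < c) :
    0 < (c • ContinuousLinearMap.id ℝ E + A).det := by
  have hc0 : 0 < c := (norm_nonneg A).trans_lt hc
  by_contra! hneg
  let f : ℝ → ℝ := fun t => (c • ContinuousLinearMap.id ℝ E + t • A).det
  have hf : Continuous f := ContinuousLinearMap.continuous_det.comp (by fun_prop)
  have hf0 : 0 ≤ f 0 := by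
    simp only [f, zero_smul, add_zero, ContinuousLinearMap.det, ContinuousLinearMap.toLinearMap_smul,
      LinearMap.det_smul, ContinuousLinearMap.coe_id, LinearMap.det_id]
    positivity
  obtain ⟨t, ht, hft⟩ : (0 : ℝ) ∈ f '' Set.Icc 0 1 :=
    intermediate_value_Icc' zero_le_one hf.continuousOn ⟨by simpa [f] using hneg, hf0⟩
  obtain ⟨v, hv, hv0⟩ := Submodule.exists_mem_ne_zero_of_ne_bot
    (LinearMap.bot_lt_ker_of_det_eq_zero hft).ne'
  have hcv : c • v = -(t • A v) := by
    have : c • v + t • A v = 0 := by simpa using hv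
    exact eq_neg_of_add_eq_zero_left this
  have hnorm : c * ‖v‖ = t * ‖A v‖ := by
    have := congrArg norm hcv
    rwa [norm_neg, norm_smul, norm_smul, Real.norm_of_nonneg hc0.le,
      Real.norm_of_nonneg ht.1] at this
  have hAv := A.le_opNorm v
  have hvpos := norm_pos_iff.mpr hv0
  nlinarith [mul_lt_mul_of_pos_right hc hvpos, norm_nonneg (A v), ht.2]

/-- The determinant of `A` is recovered by interpolation from the determinants of `c + A`
at the nodes `c = a, a + 1, …, a + dim E`. -/
theorem ContinuousLinearMap.exists_det_eq_sum_det_smul_id_add (E : Type*) [NormedAddCommGroup E]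
    [NormedSpace ℝ E] [FiniteDimensional ℝ E] (a : ℝ) :
    ∃ w : ℕ → ℝ, ∀ A : E →L[ℝ] E, A.det = ∑ i ∈ Finset.range (Module.finrank ℝ E + 1),
      w i * ((a + i) • ContinuousLinearMap.id ℝ E + A).det := by
  let s := Finset.range (Module.finrank ℝ E + 1)
  let v : ℕ → ℝ := fun i => a + i
  refine ⟨fun i => (Lagrange.basis s v i).eval 0, fun A => ?_⟩
  have hv : Set.InjOn v s := fun i _ j _ h => by simpa [v] using h
  let p := (-(A : E →ₗ[ℝ] E)).charpoly
  have hp : ∀ t : ℝ, p.eval t = (t • ContinuousLinearMap.id ℝ E + A).det := by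
    intro t
    rw [LinearMap.eval_charpoly, sub_neg_eq_add]
    rfl
  have hdeg : p.degree < s.card := by
    rw [Polynomial.degree_eq_natDegree (LinearMap.charpoly_monic _).ne_zero,
      LinearMap.charpoly_natDegree]
    rw [Finset.card_range]
    exact_mod_cast Nat.lt_succ_self _
  have h := congrArg (Polynomial.eval 0) (Lagrange.eq_interpolate hv hdeg)
  rw [hp, zero_smul, zero_add, Lagrange.interpolate_apply, Polynomial.eval_finsetSum] at h
  rw [h]
  refine Finset.sum_congr rfl fun i _ => ?_
  rw [Polynomial.eval_mul, Polynomial.eval_C, hp, mul_comm]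

theorem LipschitzWith.bijective_smul_add {E : Type*} [NormedAddCommGroup E] [NormedSpace ℝ E]
    [CompleteSpace E] {f : E → E} {L : NNReal} (hf : LipschitzWith L f) {c : ℝ} (hc : L < c) :
    Function.Bijective fun x => c • x + f x := by
  have hc0 : 0 < c := L.coe_nonneg.trans_lt hc
  rw [Function.bijective_iff_existsUnique]
  intro y
  have hcontr : ContractingWith (L / c.toNNReal) fun x => c⁻¹ • (y - f x) := by
    refine ⟨?_, LipschitzWith.of_dist_le_mul fun x z => ?_⟩
    · rw [div_lt_one (by simpa using hc0)]
      exact (Real.lt_toNNReal_iff_coe_lt).mpr hc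
    · rw [dist_smul₀, dist_sub_left, NNReal.coe_div, Real.coe_toNNReal _ hc0.le,
        Real.norm_of_nonneg (inv_nonneg.mpr hc0.le), div_mul_eq_mul_div, div_eq_inv_mul]
      exact mul_le_mul_of_nonneg_left (hf.dist_le_mul x z) (inv_nonneg.mpr hc0.le)
  have key : ∀ x, c • x + f x = y ↔ Function.IsFixedPt (fun x => c⁻¹ • (y - f x)) x := by
    intro x
    rw [Function.IsFixedPt, inv_smul_eq_iff₀ hc0.ne', sub_eq_iff_eq_add, eq_comm]
  exact ⟨_, (key _).mpr hcontr.fixedPoint_isFixedPt,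
    fun x hx => hcontr.fixedPoint_unique ((key x).mp hx)⟩

theorem image_eq_image_of_bijective_of_eqOn_compl {α β : Type*} {f g : α → β} {s : Set α}
    (hf : Function.Bijective f) (hg : Function.Bijective g) (h : Set.EqOn f g sᶜ) :
    f '' s = g '' s := by
  rw [← compl_inj_iff, ← Set.image_compl_eq hf, ← Set.image_compl_eq hg, h.image_eq]

/-- The determinant is a null Lagrangian: two `C¹` maps which agree off a compact set have the
same integral of the Jacobian determinant over that set. -/
theorem setIntegral_det_fderiv_eq_of_eqOn_compl {ι : Type*} [Fintype ι]
    {f g : (ι → ℝ) → (ι → ℝ)} (hf : ContDiff ℝ 1 f) (hg : ContDiff ℝ 1 g)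
    {K : Set (ι → ℝ)} (hK : IsCompact K) (hfg : Set.EqOn f g Kᶜ) :
    ∫ x in K, (fderiv ℝ f x).det = ∫ x in K, (fderiv ℝ g x).det := by
  obtain ⟨R, hR⟩ := hK.isBounded.subset_ball (0 : ι → ℝ)
  obtain ⟨L, hL⟩ := hf.contDiffOn.exists_lipschitzOnWith one_ne_zero
    (convex_closedBall (0 : ι → ℝ) R) (isCompact_closedBall _ _)
  obtain ⟨F, hF, hFf⟩ := hL.extend_pi
  have hsupp : HasCompactSupport fun x => g x - f x :=
    HasCompactSupport.intro hK fun x hx => by rw [hfg hx, sub_self]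
  obtain ⟨M, hM⟩ :=
    ContDiff.lipschitzWith_of_hasCompactSupport hsupp (hg.sub hf) one_ne_zero
  have hG : LipschitzWith (L + M) fun x => F x + (g x - f x) := hF.add hM
  have hFeq : ∀ x ∈ K, F =ᶠ[nhds x] f := fun x hx =>
    Filter.eventuallyEq_of_mem (Metric.isOpen_ball.mem_nhds (hR hx))
      fun y hy => (hFf (Metric.ball_subset_closedBall hy)).symm
  have hFd : ∀ x ∈ K, HasFDerivAt F (fderiv ℝ f x) x := fun x hx =>
    ((hf.differentiable one_ne_zero x).hasFDerivAt).congr_of_eventuallyEq (hFeq x hx)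
  have hGd : ∀ x ∈ K, HasFDerivAt (fun x => F x + (g x - f x)) (fderiv ℝ g x) x := fun x hx =>
    ((hg.differentiable one_ne_zero x).hasFDerivAt).congr_of_eventuallyEq
      ((hFeq x hx).mono fun y hy => by simp [hy])
  obtain ⟨a, ha⟩ : ∃ a : ℝ, (L + M : NNReal) < a ∧ (∀ x ∈ K, ‖fderiv ℝ f x‖ < a) ∧
      ∀ x ∈ K, ‖fderiv ℝ g x‖ < a := by
    obtain ⟨B, hB⟩ := hK.exists_bound_of_continuousOn (hf.continuous_fderiv one_ne_zero).continuousOn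
    obtain ⟨C, hC⟩ := hK.exists_bound_of_continuousOn (hg.continuous_fderiv one_ne_zero).continuousOn
    refine ⟨max ((L + M : NNReal) : ℝ) (max B C) + 1, ?_, fun x hx => ?_, fun x hx => ?_⟩
    · exact (le_max_left _ _).trans_lt (lt_add_one _)
    · exact ((hB x hx).trans (by simp)).trans_lt (lt_add_one _)
    · exact ((hC x hx).trans (by simp)).trans_lt (lt_add_one _)
  have hvol : ∀ c : ℝ, a ≤ c →
      ∫ x in K, (c • ContinuousLinearMap.id ℝ (ι → ℝ) + fderiv ℝ f x).det =
        ∫ x in K, (c • ContinuousLinearMap.id ℝ (ι → ℝ) + fderiv ℝ g x).det := by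
    intro c hc
    have hvol' : ∀ (h : (ι → ℝ) → (ι → ℝ)) (h' : (ι → ℝ) → (ι → ℝ) →L[ℝ] (ι → ℝ)),
        (∀ x ∈ K, HasFDerivAt h (h' x) x) → (∀ x ∈ K, ‖h' x‖ < a) →
        (Function.Injective fun x => c • x + h x) →
        ∫ x in K, (c • ContinuousLinearMap.id ℝ (ι → ℝ) + h' x).det =
          volume.real ((fun x => c • x + h x) '' K) := by
      intro h h' hd hn hinj
      have := integral_image_eq_integral_abs_det_fderiv_smul volume hK.measurableSet
        (f := fun x => c • x + h x)
        (f' := fun x => c • ContinuousLinearMap.id ℝ (ι → ℝ) + h' x)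
        (fun x hx => (((hasFDerivAt_id x).const_smul c).add (hd x hx)).hasFDerivWithinAt)
        hinj.injOn (fun _ => (1 : ℝ))
      rw [setIntegral_const, smul_eq_mul, mul_one] at this
      rw [this]
      refine setIntegral_congr_fun hK.measurableSet fun x hx => ?_
      simp only [smul_eq_mul, mul_one]
      rw [abs_of_pos (ContinuousLinearMap.det_smul_id_add_pos _ ((hn x hx).trans_le hc))]
    have hbF := hF.bijective_smul_add (c := c) (lt_of_le_of_lt (by simp) (ha.1.trans_le hc))
    have hbG := hG.bijective_smul_add (ha.1.trans_le hc)
    rw [hvol' F _ hFd ha.2.1 hbF.injective, hvol' _ _ hGd ha.2.2 hbG.injective,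
      image_eq_image_of_bijective_of_eqOn_compl hbF hbG fun x hx => by simp [hfg hx]]
  obtain ⟨w, hw⟩ := ContinuousLinearMap.exists_det_eq_sum_det_smul_id_add (ι → ℝ) a
  have hint : ∀ (h : (ι → ℝ) → (ι → ℝ)), ContDiff ℝ 1 h → ∀ i : ℕ,
      Integrable (fun x => w i * ((a + i) • ContinuousLinearMap.id ℝ (ι → ℝ) +
        fderiv ℝ h x).det) (volume.restrict K) := fun h hh i =>
    (Continuous.continuousOn (continuous_const.mul (ContinuousLinearMap.continuous_det.comp
      (continuous_const.add (hh.continuous_fderiv one_ne_zero))))).integrableOn_compact hK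
  simp_rw [hw (fderiv ℝ _ _)]
  rw [integral_finsetSum _ fun i _ => hint f hf i, integral_finsetSum _ fun i _ => hint g hg i]
  refine Finset.sum_congr rfl fun i _ => ?_
  rw [integral_const_mul, integral_const_mul, hvol _ (by simp)]

theorem Matrix.det_toContinuousLinearMap_mulVecLin {ι : Type*} [Fintype ι] [DecidableEq ι]
    (A : Matrix ι ι ℝ) : (LinearMap.toContinuousLinearMap A.mulVecLin).det = A.det :=
  LinearMap.det_toLin' A

theorem Matrix.sqrt_det_half_add_transpose_le {n : Type*} [Fintype n] [DecidableEq n]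
    {A : Matrix n n ℝ} (hA : (A + Aᵀ).PosDef) :
    √((1 / 2 : ℝ) • (A + Aᵀ)).det ≤ (1 + A.det) / 2 ∧
      (√((1 / 2 : ℝ) • (A + Aᵀ)).det = (1 + A.det) / 2 → A.IsSymm ∧ A.det = 1) := by
  obtain ⟨hle, hsymm⟩ := Matrix.det_half_add_transpose_le_det hA
  have hpos : 0 < ((1 / 2 : ℝ) • (A + Aᵀ)).det :=
    (hA.smul (by norm_num : (0 : ℝ) < 1 / 2)).det_pos
  generalize ((1 / 2 : ℝ) • (A + Aᵀ)).det = d at *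
  have hsq := Real.sq_sqrt hpos.le
  refine ⟨by nlinarith [sq_nonneg (√d - 1)], fun h => ?_⟩
  have h1 : √d = 1 := by nlinarith [sq_nonneg (√d - 1)]
  have hd : A.det = 1 := by linarith
  exact ⟨hsymm (by rw [hd, ← hsq, h1, one_pow]), hd⟩

theorem ContDiffOn.contDiffOn_gradient_pi {ι : Type*} [Fintype ι]
    {g : (ι → ℝ) → ℝ} {Dg : (ι → ℝ) → (ι → ℝ)} {U : Set (ι → ℝ)} (hU : IsOpen U)
    (hg : ContDiffOn ℝ 2 g U)
    (hDg : ∀ x ∈ U, HasFDerivAt g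
      (∑ i : ι, Dg x i • (ContinuousLinearMap.proj i : (ι → ℝ) →L[ℝ] ℝ)) x) :
    ContDiffOn ℝ 1 Dg U := by
  classical
  rw [contDiffOn_pi]
  intro i
  refine ((hg.fderiv_of_isOpen hU (m := 1) (by norm_num)).clm_apply
    (contDiffOn_const (c := (Pi.single i 1 : ι → ℝ)))).congr fun x hx => ?_
  rw [(hDg x hx).fderiv]
  simp [Pi.single_apply]

/-- **Theorem 5.3 of Harvey–Lawson, "Split Special Lagrangian Geometry" for graphs in
null coordinates**: the split SLAG graph of `∇g` (where `Hess g > 0` and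
`det Hess g = 1` near the closure of a bounded open set `Ω`) is volume-maximizing among
space-like graphs `{(u, H(u))}` agreeing with it outside a compact subset of `Ω`:
`∫_Ω √(det(½(DH + DHᵀ))) ≤ vol(Ω)`, with equality iff `DH` is symmetric with
`det DH = 1` throughout `Ω`. -/
theorem splitSLAG_volume_maximizing_null_graphs (n : ℕ) (Ω : Set (Fin n → ℝ))
    (hΩopen : IsOpen Ω) (hΩbdd : Bornology.IsBounded Ω)
    (g : (Fin n → ℝ) → ℝ) (Dg : (Fin n → ℝ) → (Fin n → ℝ))
    (Hg : (Fin n → ℝ) → Matrix (Fin n) (Fin n) ℝ)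
    (U : Set (Fin n → ℝ)) (hUopen : IsOpen U) (hU : closure Ω ⊆ U)
    (hg : ContDiffOn ℝ 2 g U)
    (hDg : ∀ x ∈ U, HasFDerivAt g
      (∑ i : Fin n, Dg x i • (ContinuousLinearMap.proj i : (Fin n → ℝ) →L[ℝ] ℝ)) x)
    (hHg : ∀ x ∈ U, HasFDerivAt Dg
      (LinearMap.toContinuousLinearMap (Matrix.mulVecLin (Hg x))) x)
    (hMA : ∀ x ∈ U, (Hg x).PosDef ∧ (Hg x).det = 1)
    (H : (Fin n → ℝ) → (Fin n → ℝ)) (DH : (Fin n → ℝ) → Matrix (Fin n) (Fin n) ℝ)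
    (hDH : ∀ x, HasFDerivAt H
      (LinearMap.toContinuousLinearMap (Matrix.mulVecLin (DH x))) x)
    (hDHcont : Continuous DH)
    (K : Set (Fin n → ℝ)) (hK : IsCompact K) (hKΩ : K ⊆ Ω)
    (hHK : {x | H x ≠ Dg x} ⊆ K)
    (hspace : ∀ x ∈ Ω, (DH x + (DH x)ᵀ).PosDef) :
    (∫ x in Ω, Real.sqrt (((1 / 2 : ℝ) • (DH x + (DH x)ᵀ)).det)) ≤ (volume Ω).toReal ∧
    ((∫ x in Ω, Real.sqrt (((1 / 2 : ℝ) • (DH x + (DH x)ᵀ)).det)) = (volume Ω).toReal ↔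
      ∀ x ∈ Ω, (DH x).IsSymm ∧ (DH x).det = 1) := by
  have hΩmeas : MeasurableSet Ω := hΩopen.measurableSet
  have hintΩ : ∀ f : (Fin n → ℝ) → ℝ, Continuous f → IntegrableOn f Ω := fun f hf =>
    (hf.continuousOn.integrableOn_compact hΩbdd.isCompact_closure).mono_set subset_closure
  have hHd : ∀ x, fderiv ℝ H x = LinearMap.toContinuousLinearMap (Matrix.mulVecLin (DH x)) :=
    fun x => (hDH x).fderiv
  have hH : ContDiff ℝ 1 H := by
    refine contDiff_one_iff_fderiv.mpr ⟨fun x => (hDH x).differentiableAt, ?_⟩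
    simp_rw [funext hHd]
    exact (LinearMap.continuous_of_finiteDimensional
      ((LinearMap.toContinuousLinearMap :
        ((Fin n → ℝ) →ₗ[ℝ] (Fin n → ℝ)) ≃ₗ[ℝ] _).toLinearMap ∘ₗ
        (Matrix.toLin' : Matrix (Fin n) (Fin n) ℝ ≃ₗ[ℝ] _).toLinearMap)).comp hDHcont
  have heq : Set.EqOn H Dg Kᶜ := fun x hx => by
    by_contra hne
    exact hx (hHK hne)
  have heq' : ∀ x ∉ K, Dg =ᶠ[nhds x] H := fun x hx =>
    Filter.eventuallyEq_of_mem (hK.isClosed.isOpen_compl.mem_nhds hx) heq.symm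
  have hΩU : Ω ⊆ U := subset_closure.trans hU
  have hDgC : ContDiff ℝ 1 Dg := by
    refine contDiff_iff_contDiffAt.mpr fun x => ?_
    by_cases hx : x ∈ K
    · exact (hg.contDiffOn_gradient_pi hUopen hDg).contDiffAt (hUopen.mem_nhds (hΩU (hKΩ hx)))
    · exact hH.contDiffAt.congr_of_eventuallyEq (heq' x hx)
  have hdetcont : Continuous fun x => (DH x).det := hDHcont.matrix_det
  have hdetG : ∀ x ∈ U, (fderiv ℝ Dg x).det = 1 := fun x hx => by
    rw [(hHg x hx).fderiv, Matrix.det_toContinuousLinearMap_mulVecLin, (hMA x hx).2]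
  have hdetH : ∀ x, (fderiv ℝ H x).det = (DH x).det := fun x => by
    rw [hHd, Matrix.det_toContinuousLinearMap_mulVecLin]
  have hintdet : ∫ x in Ω, ((DH x).det - 1) = 0 := by
    have hzero : ∀ x ∈ Ω \ K, (DH x).det - 1 = 0 := fun x hx => by
      rw [← hdetH, ← (heq' x hx.2).fderiv_eq, hdetG x (hΩU hx.1), sub_self]
    rw [setIntegral_eq_of_subset_of_forall_sdiff_eq_zero hΩmeas hKΩ hzero,
      integral_sub (hdetcont.continuousOn.integrableOn_compact hK)
        (continuous_const.continuousOn.integrableOn_compact hK), sub_eq_zero]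
    simp_rw [← hdetH]
    rw [setIntegral_det_fderiv_eq_of_eqOn_compl hH hDgC hK heq]
    exact setIntegral_congr_fun hK.measurableSet fun x hx => hdetG x (hΩU (hKΩ hx))
  let vol : (Fin n → ℝ) → ℝ := fun x => √((1 / 2 : ℝ) • (DH x + (DH x)ᵀ)).det
  have hvolcont : Continuous vol :=
    ((hDHcont.add hDHcont.matrix_transpose).const_smul (1 / 2 : ℝ)).matrix_det.sqrt
  let gap : (Fin n → ℝ) → ℝ := fun x => (1 + (DH x).det) / 2 - vol x
  have hgapcont : Continuous gap := ((continuous_const.add hdetcont).div_const 2).sub hvolcont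
  have hgap : ∀ x ∈ Ω, 0 ≤ gap x := fun x hx =>
    sub_nonneg.mpr (Matrix.sqrt_det_half_add_transpose_le (hspace x hx)).1
  have hgapint : ∫ x in Ω, gap x = (volume Ω).toReal - ∫ x in Ω, vol x := by
    have e : ∀ x, gap x = (1 / 2 * ((DH x).det - 1) + 1) - vol x := fun x => by
      simp only [gap]; ring
    simp_rw [e]
    rw [integral_sub (hintΩ _ (by fun_prop)) (hintΩ _ hvolcont),
      integral_add (hintΩ _ (by fun_prop)) (hintΩ _ continuous_const), integral_const_mul,
      hintdet, setIntegral_const, smul_eq_mul, mul_one, mul_zero, zero_add, Measure.real]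
  change ∫ x in Ω, vol x ≤ _ ∧ (∫ x in Ω, vol x = _ ↔ _)
  refine ⟨?_, fun h x hx => ?_, fun h => ?_⟩
  · linarith [setIntegral_nonneg (μ := volume) hΩmeas hgap]
  · have hae : gap =ᵐ[volume.restrict Ω] 0 := by
      rw [← setIntegral_eq_zero_iff_of_nonneg_ae
        ((ae_restrict_iff' hΩmeas).mpr (ae_of_all _ hgap)) (hintΩ _ hgapcont), hgapint, h, sub_self]
    have hx0 : gap x = 0 :=
      Measure.eqOn_open_of_ae_eq hae hΩopen hgapcont.continuousOn continuousOn_const hx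
    exact (Matrix.sqrt_det_half_add_transpose_le (hspace x hx)).2 (sub_eq_zero.mp hx0).symm
  · have hvol1 : ∀ x ∈ Ω, vol x = 1 := fun x hx => by
      obtain ⟨hs, hd⟩ := h x hx
      have e : (1 / 2 : ℝ) • (DH x + (DH x)ᵀ) = DH x := by
        rw [hs.eq]; module
      simp only [vol, e, hd, Real.sqrt_one]
    rw [setIntegral_congr_fun hΩmeas hvol1, setIntegral_const, smul_eq_mul, mul_one, Measure.real]
end

section
/- Let P be an n-dimensional linear subspace of ℝ^n × ℝ^n. Then the split inner product ⟨(x,y),(x',y')⟩ = x⋅x' − y⋅y' is positive definite on P and the symplectic form ω((x,y),(x',y')) = x⋅y' − y⋅x' vanishes identically on P if and only if there exists a (unique) symmetric real n×n matrix A with AᵀA < I in the Loewner order (equivalently −I < A < I) such that P = {(x, Ax) : x ∈ ℝ^n}. -/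
open Matrix

theorem Matrix.dotProduct_one_sub_transpose_mul_self_mulVec {n : Type*} [Fintype n] [DecidableEq n]
    (A : Matrix n n ℝ) (x : n → ℝ) :
    x ⬝ᵥ ((1 - Aᵀ * A) *ᵥ x) = x ⬝ᵥ x - (A *ᵥ x) ⬝ᵥ (A *ᵥ x) := by
  rw [sub_mulVec, one_mulVec, dotProduct_sub, ← mulVec_mulVec, dotProduct_mulVec x,
    vecMul_transpose]

theorem Matrix.posDef_one_sub_transpose_mul_self_iff {n : Type*} [Fintype n] [DecidableEq n]
    {A : Matrix n n ℝ} :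
    (1 - Aᵀ * A).PosDef ↔ ∀ x, x ≠ 0 → 0 < x ⬝ᵥ x - (A *ᵥ x) ⬝ᵥ (A *ᵥ x) := by
  have hA : (1 - Aᵀ * A).IsHermitian :=
    isHermitian_one.sub (isHermitian_conjTranspose_mul_self A)
  simp only [posDef_iff_dotProduct_mulVec, hA, true_and, star_trivial,
    dotProduct_one_sub_transpose_mul_self_mulVec]

theorem Matrix.isSymm_iff_dotProduct_mulVec {n R : Type*} [Fintype n] [CommRing R]
    {A : Matrix n n R} :
    A.IsSymm ↔ ∀ x y, x ⬝ᵥ (A *ᵥ y) = (A *ᵥ x) ⬝ᵥ y := by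
  classical
  refine ⟨fun h x y => ?_, fun h => IsSymm.ext fun i j => ?_⟩
  · rw [dotProduct_mulVec, ← mulVec_transpose, h.eq]
  · simpa using (h (Pi.single i 1) (Pi.single j 1)).symm

/-- A subspace of `V × W` of the same dimension as `V` which meets `0 × W` trivially is the graph
of a linear map. -/
theorem Submodule.exists_eq_graph_of_finrank_eq {K V W : Type*} [Field K]
    [AddCommGroup V] [Module K V] [FiniteDimensional K V]
    [AddCommGroup W] [Module K W] [FiniteDimensional K W]
    (P : Submodule K (V × W)) (hdim : Module.finrank K P = Module.finrank K V)
    (hP : ∀ p ∈ P, p.1 = 0 → p = 0) : ∃ f : V →ₗ[K] W, P = f.graph := by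
  let π : P →ₗ[K] V := LinearMap.fst K V W ∘ₗ P.subtype
  have hπ : Function.Injective π :=
    (injective_iff_map_eq_zero π).2 fun p hp => Subtype.ext (hP p p.2 hp)
  exact Submodule.exists_eq_graph
    ⟨hπ, (LinearMap.injective_iff_surjective_of_finrank_eq_finrank hdim).1 hπ⟩

/-- Characterization (6.4) of Harvey–Lawson, "Split Special Lagrangian Geometry":
an `n`-dimensional subspace `P ⊆ ℝ^n × ℝ^n = D^n` is space-like Lagrangian — the split
inner product `⟨(x,y),(x',y')⟩ = x⋅x' − y⋅y'` is positive definite on `P` and the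
symplectic form `ω((x,y),(x',y')) = x⋅y' − y⋅x'` vanishes on `P` — if and only if `P`
is the graph of a unique symmetric matrix `A` with `AᵀA < I` in the Loewner order. -/
theorem spacelike_lagrangian_plane_characterization (n : ℕ)
    (P : Submodule ℝ ((Fin n → ℝ) × (Fin n → ℝ)))
    (hdim : Module.finrank ℝ P = n) :
    ((∀ p ∈ P, p ≠ 0 → 0 < p.1 ⬝ᵥ p.1 - p.2 ⬝ᵥ p.2) ∧
      (∀ p ∈ P, ∀ q ∈ P, p.1 ⬝ᵥ q.2 - p.2 ⬝ᵥ q.1 = 0)) ↔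
    (∃! A : Matrix (Fin n) (Fin n) ℝ, A.IsSymm ∧ (1 - Aᵀ * A).PosDef ∧
      ∀ p : (Fin n → ℝ) × (Fin n → ℝ), p ∈ P ↔ p.2 = A.mulVec p.1) := by
  constructor
  · rintro ⟨hpos, hlag⟩
    obtain ⟨f, rfl⟩ := P.exists_eq_graph_of_finrank_eq (by simpa using hdim) fun p hp h => by
      by_contra hne
      have hlt := hpos p hp hne
      have hnonneg : 0 ≤ p.2 ⬝ᵥ p.2 := by simpa using dotProduct_star_self_nonneg p.2
      rw [h, zero_dotProduct] at hlt
      linarith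
    have hf (x : Fin n → ℝ) : (x, LinearMap.toMatrix' f *ᵥ x) ∈ f.graph := by
      simp [LinearMap.mem_graph_iff, LinearMap.toMatrix'_mulVec]
    refine ⟨LinearMap.toMatrix' f, ⟨?_, ?_, fun p => ?_⟩, ?_⟩
    · exact isSymm_iff_dotProduct_mulVec.2 fun x y =>
        sub_eq_zero.1 (hlag _ (hf x) _ (hf y))
    · exact posDef_one_sub_transpose_mul_self_iff.2 fun x hx =>
        hpos _ (hf x) fun h => hx (congrArg Prod.fst h)
    · rw [LinearMap.mem_graph_iff, LinearMap.toMatrix'_mulVec]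
    · rintro B ⟨-, -, hB⟩
      exact ext_of_mulVec_single fun i => ((hB _).1 (hf (Pi.single i 1))).symm
  · rintro ⟨A, ⟨hsymm, hpos, hA⟩, -⟩
    refine ⟨fun p hp hne => ?_, fun p hp q hq => ?_⟩
    · have h := (hA p).1 hp
      rw [h]
      refine posDef_one_sub_transpose_mul_self_iff.1 hpos p.1 fun h₁ => hne (Prod.ext h₁ ?_)
      rw [h, h₁, mulVec_zero, Prod.snd_zero]
    · rw [(hA p).1 hp, (hA q).1 hq, sub_eq_zero]
      exact isSymm_iff_dotProduct_mulVec.1 hsymm _ _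
end

section
/- Let P be an n-dimensional linear subspace of ℝ^n × ℝ^n on which the split inner product ⟨(x,y),(x',y')⟩ = x⋅x' − y⋅y' is positive definite. Then there exist vectors e₁,…,e_n ∈ ℝ^n × ℝ^n with ⟨e_i, e_j⟩ = δ_ij and ⟨e_i, T e_j⟩ = 0 for all i,j (where T(x,y) = (y,x); necessarily ⟨Te_i, Te_j⟩ = −δ_ij, so e₁,…,e_n,Te₁,…,Te_n is a space-like D-unitary basis of ℝ^{2n}), and real numbers θ₁ ≥ θ₂ ≥ … ≥ θ_m ≥ 0 with m = ⌊n/2⌋, such that the n vectors ε_{2j−1} := e_{2j−1} and ε_{2j} := cosh(θ_j) e_{2j} + sinh(θ_j) T e_{2j−1} for 1 ≤ j ≤ m, together with ε_n := e_n when n is odd, form a basis of P which is orthonormal for the split inner product. -/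
open Matrix

/-- The split inner product on `D^n = ℝ^n × ℝ^n`: `⟨(x,y),(x',y')⟩ = x⋅x' − y⋅y'`. -/
def splitIP {n : ℕ} (v w : (Fin n → ℝ) × (Fin n → ℝ)) : ℝ :=
  v.1 ⬝ᵥ w.1 - v.2 ⬝ᵥ w.2

/-- Multiplication by `τ` on `D^n = ℝ^n × ℝ^n`: `T(x,y) = (y,x)`. -/
def tauMap {n : ℕ} (v : (Fin n → ℝ) × (Fin n → ℝ)) : (Fin n → ℝ) × (Fin n → ℝ) :=
  (v.2, v.1)

open Module

section SkewNormalForm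

variable {E : Type*} [NormedAddCommGroup E] [InnerProductSpace ℝ E]

/-- `ε 0, …, ε (n - 1)` is an orthonormal family in `V` that brings the skew form `ω` into
block-diagonal form with nonnegative, nonincreasing entries `ω (ε (2 * j)) (ε (2 * j + 1))`. -/
structure IsSkewNormalFrame {M : Type*} [AddCommGroup M] [Module ℝ M] (g : M → M → ℝ)
    (ω : M →ₗ[ℝ] M →ₗ[ℝ] ℝ) (V : Submodule ℝ M) (n : ℕ) (ε : ℕ → M) : Prop where
  mem : ∀ i < n, ε i ∈ V
  orthonormal : ∀ i < n, ∀ j < n, g (ε i) (ε j) = if i = j then 1 else 0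
  block : ∀ i < n, ∀ j < n, i / 2 ≠ j / 2 → ω (ε i) (ε j) = 0
  nonneg : ∀ j, 2 * j + 1 < n → 0 ≤ ω (ε (2 * j)) (ε (2 * j + 1))
  antitone : ∀ j k, j ≤ k → 2 * k + 1 < n →
    ω (ε (2 * k)) (ε (2 * k + 1)) ≤ ω (ε (2 * j)) (ε (2 * j + 1))

/-- A linear form bounded by its value at a unit vector `v` vanishes on vectors orthogonal
to `v`. -/
lemma eq_zero_of_le_apply_mul_norm (f : E →ₗ[ℝ] ℝ) {v w : E} (hv : ‖v‖ = 1)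
    (hvw : inner ℝ v w = 0) (hf : ∀ t : ℝ, |f (v + t • w)| ≤ f v * ‖v + t • w‖) : f w = 0 := by
  have key : ∀ t : ℝ,
      0 ≤ ((f v) ^ 2 * ‖w‖ ^ 2 - (f w) ^ 2) * (t * t) + (-(2 * f v * f w)) * t + 0 := by
    intro t
    have h1 := hf t
    have h2 : ‖v + t • w‖ ^ 2 = 1 + t ^ 2 * ‖w‖ ^ 2 := by
      rw [norm_add_sq_real, inner_smul_right, hvw, hv, norm_smul, Real.norm_eq_abs, mul_pow,
        sq_abs]
      ring
    have h3 : (f (v + t • w)) ^ 2 ≤ (f v * ‖v + t • w‖) ^ 2 := by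
      rw [← sq_abs (f (v + t • w))]
      exact pow_le_pow_left₀ (abs_nonneg _) h1 2
    rw [mul_pow, h2, map_add, map_smul, smul_eq_mul] at h3
    nlinarith
  have hd := discrim_le_zero key
  have h0 : f v * f w = 0 := by
    have : (f v * f w) ^ 2 ≤ 0 := by unfold discrim at hd; nlinarith
    exact pow_eq_zero_iff two_ne_zero |>.1 (le_antisymm this (sq_nonneg _))
  rcases mul_eq_zero.1 h0 with h | h
  · have := key 1
    rw [h] at this
    exact pow_eq_zero_iff two_ne_zero |>.1 (le_antisymm (by nlinarith) (sq_nonneg (f w)))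
  · exact h

/-- A bilinear form attains its maximum over orthonormal pairs in a subspace of dimension
at least two. -/
lemma exists_orthonormal_pair_forall_le [FiniteDimensional ℝ E] (ω : E →ₗ[ℝ] E →ₗ[ℝ] ℝ)
    (V : Submodule ℝ E) (hV : 2 ≤ finrank ℝ V) :
    ∃ u ∈ V, ∃ v ∈ V, ‖u‖ = 1 ∧ ‖v‖ = 1 ∧ inner ℝ u v = 0 ∧
      ∀ x ∈ V, ∀ y ∈ V, ‖x‖ = 1 → ‖y‖ = 1 → inner ℝ x y = 0 → ω x y ≤ ω u v := by
  let S : Set (E × E) := {p | (p.1 ∈ V ∧ p.2 ∈ V) ∧ inner ℝ p.1 p.2 = 0} ∩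
    Metric.sphere (0 : E) 1 ×ˢ Metric.sphere (0 : E) 1
  have hVc : IsClosed (V : Set E) := V.closed_of_finiteDimensional
  have hS : IsCompact S := by
    refine ((isCompact_sphere _ _).prod (isCompact_sphere _ _)).inter_left ?_
    refine ((hVc.preimage continuous_fst).inter (hVc.preimage continuous_snd)).inter ?_
    exact isClosed_eq (by fun_prop) continuous_const
  have hne : S.Nonempty := by
    let b := stdOrthonormalBasis ℝ V
    let i : Fin (finrank ℝ V) := ⟨0, by omega⟩
    let j : Fin (finrank ℝ V) := ⟨1, by omega⟩
    have hij : i ≠ j := by simp [i, j]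
    refine ⟨((b i : V), (b j : V)), ⟨⟨(b i).2, (b j).2⟩, ?_⟩, ?_⟩
    · simpa using b.orthonormal.2 hij
    · have hi := b.orthonormal.1 i
      have hj := b.orthonormal.1 j
      simp only [Submodule.coe_norm] at hi hj
      simp [hi, hj]
  have hcont : Continuous fun p : E × E => ω p.1 p.2 := by
    have h1 : Continuous fun x : E => LinearMap.toContinuousLinearMap (ω x) :=
      (LinearMap.toContinuousLinearMap.toLinearMap ∘ₗ ω).continuous_of_finiteDimensional
    exact (h1.comp continuous_fst).clm_apply continuous_snd
  obtain ⟨⟨u, v⟩, ⟨⟨⟨hu, hv⟩, huv⟩, hn⟩, hmax⟩ := hS.exists_isMaxOn hne hcont.continuousOn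
  simp only [Set.mem_prod, mem_sphere_zero_iff_norm] at hn
  refine ⟨u, hu, v, hv, hn.1, hn.2, huv, fun x hx y hy hx1 hy1 hxy => ?_⟩
  exact hmax (a := (x, y)) ⟨⟨⟨hx, hy⟩, hxy⟩, by simp [hx1, hy1]⟩

/-- If `(u, v)` maximises `ω` over orthonormal pairs, then `ω u` vanishes on vectors orthogonal
to both. -/
lemma apply_eq_zero_of_forall_le {ω : E →ₗ[ℝ] E →ₗ[ℝ] ℝ} {V : Submodule ℝ E}
    {u v w : E} (hu : u ∈ V) (hv : v ∈ V) (hw : w ∈ V) (hu1 : ‖u‖ = 1) (hv1 : ‖v‖ = 1)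
    (huv : inner ℝ u v = 0) (huw : inner ℝ u w = 0) (hvw : inner ℝ v w = 0)
    (hmax : ∀ x ∈ V, ∀ y ∈ V, ‖x‖ = 1 → ‖y‖ = 1 → inner ℝ x y = 0 → ω x y ≤ ω u v) :
    ω u w = 0 := by
  have bound : ∀ y ∈ V, inner ℝ u y = 0 → ω u y ≤ ω u v * ‖y‖ := by
    intro y hy huy
    rcases eq_or_ne y 0 with rfl | hy0
    · simp
    have hn : 0 < ‖y‖ := norm_pos_iff.2 hy0
    have := hmax u hu (‖y‖⁻¹ • y) (V.smul_mem _ hy) hu1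
      (by rw [norm_smul, norm_inv, norm_norm, inv_mul_cancel₀ hn.ne'])
      (by rw [inner_smul_right, huy, mul_zero])
    rw [map_smul, smul_eq_mul, inv_mul_le_iff₀ hn] at this
    linarith
  refine eq_zero_of_le_apply_mul_norm (ω u) hv1 hvw fun t => abs_le'.2 ⟨?_, ?_⟩
  · refine bound _ (V.add_mem hv (V.smul_mem _ hw)) ?_
    simp [inner_add_right, inner_smul_right, huv, huw]
  · rw [← map_neg, ← norm_neg (v + t • w)]
    refine bound _ (V.neg_mem (V.add_mem hv (V.smul_mem _ hw))) ?_
    simp [inner_add_right, inner_smul_right, huv, huw]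

/-- The subspace of `V` orthogonal to an orthonormal pair in `V` has codimension two. -/
lemma finrank_orthogonal_pair [FiniteDimensional ℝ E] {V : Submodule ℝ E} {u v : E}
    (hu : u ∈ V) (hv : v ∈ V) (hu1 : ‖u‖ = 1) (hv1 : ‖v‖ = 1) (huv : inner ℝ u v = 0) :
    2 + finrank ℝ ((Submodule.span ℝ {u, v})ᗮ ⊓ V : Submodule ℝ E) = finrank ℝ V := by
  have hli : LinearIndependent ℝ ![u, v] := by
    refine Orthonormal.linearIndependent (𝕜 := ℝ) ⟨fun i => ?_, fun i j hij => ?_⟩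
    · fin_cases i <;> simp [hu1, hv1]
    · fin_cases i <;> fin_cases j <;> simp_all [real_inner_comm]
  have h2 : finrank ℝ (Submodule.span ℝ {u, v}) = 2 := by
    have := finrank_span_eq_card hli
    rwa [Matrix.range_cons_cons_empty, Fintype.card_fin] at this
  rw [← h2]
  refine Submodule.finrank_add_inf_finrank_orthogonal (Submodule.span_le.2 ?_)
  rintro x (rfl | rfl) <;> assumption

/-- Orthogonal normal form of an alternating form on a Euclidean space. -/
theorem exists_isSkewNormalFrame [FiniteDimensional ℝ E] {ω : E →ₗ[ℝ] E →ₗ[ℝ] ℝ}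
    (hω : ω.IsAlt) : ∀ (n : ℕ) (V : Submodule ℝ E), finrank ℝ V = n →
      ∃ ε : ℕ → E, IsSkewNormalFrame (inner ℝ) ω V n ε
  | 0, V, _ => ⟨0, by simp, by simp, by simp, by simp, by simp⟩
  | 1, V, hV => by
    let b := stdOrthonormalBasis ℝ V
    let i : Fin (finrank ℝ V) := ⟨0, by omega⟩
    have hb : ‖(b i : E)‖ = 1 := b.orthonormal.1 i
    exact ⟨fun _ => b i, by simp, by simp [hb], by simp, by simp, by simp⟩
  | n + 2, V, hV => by
    obtain ⟨u, hu, v, hv, hu1, hv1, huv, hmax⟩ :=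
      exists_orthonormal_pair_forall_le ω V (by omega)
    have hvu : inner ℝ v u = 0 := by rw [real_inner_comm, huv]
    have hrank := finrank_orthogonal_pair hu hv hu1 hv1 huv
    obtain ⟨ε, hmem, hon, hblock, hnonneg, hanti⟩ := exists_isSkewNormalFrame hω n
      ((Submodule.span ℝ {u, v})ᗮ ⊓ V : Submodule ℝ E) (by omega)
    have hεV : ∀ i < n, ε i ∈ V := fun i hi => (hmem i hi).2
    have hεu : ∀ i < n, inner ℝ u (ε i) = 0 := fun i hi =>
      (Submodule.mem_orthogonal _ _).1 (hmem i hi).1 u (Submodule.subset_span (by simp))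
    have hεv : ∀ i < n, inner ℝ v (ε i) = 0 := fun i hi =>
      (Submodule.mem_orthogonal _ _).1 (hmem i hi).1 v (Submodule.subset_span (by simp))
    have hneg : ∀ x y, ω x y = -ω y x := fun x y => (hω.neg y x).symm
    have hωu : ∀ i < n, ω u (ε i) = 0 := fun i hi =>
      apply_eq_zero_of_forall_le hu hv (hεV i hi) hu1 hv1 huv (hεu i hi) (hεv i hi) hmax
    have hωv : ∀ i < n, ω v (ε i) = 0 := fun i hi => by
      refine apply_eq_zero_of_forall_le hv (V.neg_mem hu) (hεV i hi) hv1
        (by rwa [norm_neg]) (by simp [hvu]) (hεv i hi) (by simp [hεu i hi]) ?_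
      rwa [map_neg, ← hneg u v]
    have hpos : 0 ≤ ω u v := by
      have := hmax u hu (-v) (V.neg_mem hv) hu1 (by rwa [norm_neg]) (by simp [huv])
      rw [map_neg] at this
      linarith
    have hnorm : ∀ i < n, ‖ε i‖ = 1 := fun i hi => by
      have := hon i hi i hi
      rw [real_inner_self_eq_norm_sq, if_pos rfl] at this
      exact (pow_eq_one_iff_of_nonneg (norm_nonneg _) two_ne_zero).1 this
    have hle : ∀ k, 2 * k + 1 < n → ω (ε (2 * k)) (ε (2 * k + 1)) ≤ ω u v := fun k hk =>
      hmax _ (hεV _ (by omega)) _ (hεV _ hk) (hnorm _ (by omega)) (hnorm _ hk)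
        (by rw [hon _ (by omega) _ hk, if_neg (by omega)])
    let ε' : ℕ → E := fun
      | 0 => u
      | 1 => v
      | i + 2 => ε i
    refine ⟨ε', ?_, ?_, ?_, ?_, ?_⟩
    · rintro (_ | _ | i) hi
      exacts [hu, hv, hεV i (by omega)]
    · rintro (_ | _ | i) hi (_ | _ | j) hj
      · simp [ε', hu1]
      · simp [ε', huv]
      · simp [ε', hεu j (by omega)]
      · simp [ε', hvu]
      · simp [ε', hv1]
      · simp [ε', hεv j (by omega)]
      · simp [ε', real_inner_comm, hεu i (by omega)]
      · simp [ε', real_inner_comm, hεv i (by omega)]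
      · simpa [ε'] using hon i (by omega) j (by omega)
    · rintro (_ | _ | i) hi (_ | _ | j) hj hij
      · exact absurd rfl hij
      · exact absurd rfl hij
      · exact hωu j (by omega)
      · exact absurd rfl hij
      · exact absurd rfl hij
      · exact hωv j (by omega)
      · exact (hneg _ _).trans (by rw [hωu i (by omega), neg_zero])
      · exact (hneg _ _).trans (by rw [hωv i (by omega), neg_zero])
      · exact hblock i (by omega) j (by omega) (by omega)
    · rintro (_ | j) hj
      exacts [hpos, hnonneg j (by omega)]
    · rintro (_ | j) (_ | k) hjk hk
      · exact le_rfl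
      · exact hle k (by omega)
      · omega
      · exact hanti j k (by omega) (by omega)

/-- Orthogonal normal form of an alternating form, for an inner product given by its core. -/
theorem exists_isSkewNormalFrame_core {M : Type*} [AddCommGroup M] [Module ℝ M]
    [FiniteDimensional ℝ M] (c : InnerProductSpace.Core ℝ M) {ω : M →ₗ[ℝ] M →ₗ[ℝ] ℝ}
    (hω : ω.IsAlt) : ∃ ε : ℕ → M, IsSkewNormalFrame c.inner ω ⊤ (finrank ℝ M) ε := by
  let _ : NormedAddCommGroup M := c.toNormedAddCommGroup
  let _ : InnerProductSpace ℝ M := InnerProductSpace.ofCore c.toCore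
  exact exists_isSkewNormalFrame hω _ ⊤ (finrank_top ℝ M)

end SkewNormalForm

section Split

variable {n : ℕ}

lemma splitIP_comm (v w : (Fin n → ℝ) × (Fin n → ℝ)) : splitIP v w = splitIP w v := by
  simp [splitIP, dotProduct_comm]

lemma splitIP_add_left (u v w : (Fin n → ℝ) × (Fin n → ℝ)) :
    splitIP (u + v) w = splitIP u w + splitIP v w := by
  simp [splitIP]; ring

lemma splitIP_smul_left (a : ℝ) (v w : (Fin n → ℝ) × (Fin n → ℝ)) :
    splitIP (a • v) w = a * splitIP v w := by
  simp [splitIP]; ring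

lemma splitIP_sub_left (u v w : (Fin n → ℝ) × (Fin n → ℝ)) :
    splitIP (u - v) w = splitIP u w - splitIP v w := by
  simp [splitIP]; ring

lemma splitIP_add_right (u v w : (Fin n → ℝ) × (Fin n → ℝ)) :
    splitIP u (v + w) = splitIP u v + splitIP u w := by
  simp [splitIP]; ring

lemma splitIP_smul_right (a : ℝ) (v w : (Fin n → ℝ) × (Fin n → ℝ)) :
    splitIP v (a • w) = a * splitIP v w := by
  simp [splitIP]; ring

lemma splitIP_sub_right (u v w : (Fin n → ℝ) × (Fin n → ℝ)) :
    splitIP u (v - w) = splitIP u v - splitIP u w := by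
  simp [splitIP]; ring

lemma tauMap_sub (v w : (Fin n → ℝ) × (Fin n → ℝ)) :
    tauMap (v - w) = tauMap v - tauMap w := rfl

lemma tauMap_smul (a : ℝ) (v : (Fin n → ℝ) × (Fin n → ℝ)) :
    tauMap (a • v) = a • tauMap v := rfl

lemma tauMap_tauMap (v : (Fin n → ℝ) × (Fin n → ℝ)) : tauMap (tauMap v) = v := rfl

lemma splitIP_tauMap_left (v w : (Fin n → ℝ) × (Fin n → ℝ)) :
    splitIP (tauMap v) w = -splitIP v (tauMap w) := by
  simp [splitIP, tauMap]

lemma splitIP_tauMap_self (v : (Fin n → ℝ) × (Fin n → ℝ)) : splitIP v (tauMap v) = 0 := by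
  simp [splitIP, tauMap, dotProduct_comm]

lemma splitIP_tauMap_comm (v w : (Fin n → ℝ) × (Fin n → ℝ)) :
    splitIP v (tauMap w) = -splitIP w (tauMap v) := by
  rw [splitIP_comm, splitIP_tauMap_left]

/-- The skew form `(v, w) ↦ ⟨v, Tw⟩` restricted to a subspace. -/
def splitSkew (P : Submodule ℝ ((Fin n → ℝ) × (Fin n → ℝ))) : P →ₗ[ℝ] P →ₗ[ℝ] ℝ :=
  LinearMap.mk₂ ℝ (fun v w => splitIP v.1 (tauMap w.1))
    (fun u v w => splitIP_add_left u.1 v.1 (tauMap w.1))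
    (fun a v w => splitIP_smul_left a v.1 (tauMap w.1))
    (fun u v w => splitIP_add_right u.1 (tauMap v.1) (tauMap w.1))
    (fun a v w => splitIP_smul_right a v.1 (tauMap w.1))

/-- The Euclidean structure induced by the split inner product on a space-like subspace. -/
abbrev splitCore (P : Submodule ℝ ((Fin n → ℝ) × (Fin n → ℝ)))
    (hpos : ∀ v ∈ P, v ≠ 0 → 0 < splitIP v v) : InnerProductSpace.Core ℝ P where
  inner v w := splitIP v.1 w.1
  conj_inner_symm v w := splitIP_comm _ _
  re_inner_nonneg v := by
    rcases eq_or_ne v.1 0 with h | h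
    · simp [h, splitIP]
    · exact (hpos v.1 v.2 h).le
  add_left _ _ _ := splitIP_add_left _ _ _
  smul_left _ _ _ := splitIP_smul_left _ _ _
  definite v hv := by
    by_contra h
    exact (hpos v.1 v.2 (by simpa using h)).ne' hv

/-- Every space-like plane has a split-orthonormal frame which brings the skew form
`(v, w) ↦ ⟨v, Tw⟩` into normal form. -/
lemma exists_split_frame (P : Submodule ℝ ((Fin n → ℝ) × (Fin n → ℝ)))
    (hdim : finrank ℝ P = n) (hpos : ∀ v ∈ P, v ≠ 0 → 0 < splitIP v v) :
    ∃ ε : ℕ → (Fin n → ℝ) × (Fin n → ℝ),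
      (∀ i < n, ε i ∈ P) ∧
      (∀ i < n, ∀ j < n, splitIP (ε i) (ε j) = if i = j then 1 else 0) ∧
      (∀ i < n, ∀ j < n, i / 2 ≠ j / 2 → splitIP (ε i) (tauMap (ε j)) = 0) ∧
      (∀ j, 2 * j + 1 < n → 0 ≤ splitIP (ε (2 * j)) (tauMap (ε (2 * j + 1)))) ∧
      ∀ j k, j ≤ k → 2 * k + 1 < n → splitIP (ε (2 * k)) (tauMap (ε (2 * k + 1))) ≤
        splitIP (ε (2 * j)) (tauMap (ε (2 * j + 1))) := by
  obtain ⟨ε, h⟩ := exists_isSkewNormalFrame_core (splitCore P hpos) (ω := splitSkew P)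
    (fun v => splitIP_tauMap_self v.1)
  rw [hdim] at h
  exact ⟨fun i => ε i, fun i _ => (ε i).2, h.orthonormal, h.block, h.nonneg, h.antitone⟩

/-- A split-orthonormal family is linearly independent. -/
lemma linearIndependent_of_splitIP {ι : Type*} [Fintype ι] [DecidableEq ι]
    {ε : ι → (Fin n → ℝ) × (Fin n → ℝ)}
    (h : ∀ i j, splitIP (ε i) (ε j) = if i = j then 1 else 0) : LinearIndependent ℝ ε := by
  rw [Fintype.linearIndependent_iff]
  intro a ha j
  let f : ((Fin n → ℝ) × (Fin n → ℝ)) →ₗ[ℝ] ℝ :=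
    { toFun := fun v => splitIP v (ε j)
      map_add' := fun _ _ => splitIP_add_left _ _ _
      map_smul' := fun _ _ => splitIP_smul_left _ _ _ }
  have hf : f (∑ i, a i • ε i) = a j := by
    rw [map_sum]
    simp [f, h]
  rw [← hf, ha, map_zero]

/-- The space-like vector `e` with `ε' = cosh θ • e + sinh θ • T ε`, where
`sinh θ = ⟨ε, T ε'⟩`. -/
noncomputable def untwist (ε ε' : (Fin n → ℝ) × (Fin n → ℝ)) : (Fin n → ℝ) × (Fin n → ℝ) :=
  (Real.cosh (Real.arsinh (splitIP ε (tauMap ε'))))⁻¹ •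
    (ε' - splitIP ε (tauMap ε') • tauMap ε)

/-- The `D`-unitary frame underlying a frame in normal form. -/
noncomputable def unitaryFrame (ε : ℕ → (Fin n → ℝ) × (Fin n → ℝ)) (i : ℕ) :
    (Fin n → ℝ) × (Fin n → ℝ) :=
  if i % 2 = 0 then ε i else untwist (ε (i - 1)) (ε i)

lemma unitaryFrame_even (ε : ℕ → (Fin n → ℝ) × (Fin n → ℝ)) (a : ℕ) :
    unitaryFrame ε (2 * a) = ε (2 * a) := by
  simp [unitaryFrame]

lemma unitaryFrame_odd (ε : ℕ → (Fin n → ℝ) × (Fin n → ℝ)) (a : ℕ) :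
    unitaryFrame ε (2 * a + 1) = untwist (ε (2 * a)) (ε (2 * a + 1)) := by
  simp [unitaryFrame, Nat.add_mod]

lemma splitIP_untwist_left (u v w : (Fin n → ℝ) × (Fin n → ℝ)) :
    splitIP (untwist u v) w = (Real.cosh (Real.arsinh (splitIP u (tauMap v))))⁻¹ *
      (splitIP v w + splitIP u (tauMap v) * splitIP u (tauMap w)) := by
  rw [untwist, splitIP_smul_left, splitIP_sub_left, splitIP_smul_left, splitIP_tauMap_left]
  ring

lemma splitIP_tauMap_untwist (u v w : (Fin n → ℝ) × (Fin n → ℝ)) :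
    splitIP w (tauMap (untwist u v)) = (Real.cosh (Real.arsinh (splitIP u (tauMap v))))⁻¹ *
      (splitIP w (tauMap v) - splitIP u (tauMap v) * splitIP w u) := by
  rw [untwist, tauMap_smul, tauMap_sub, tauMap_smul, tauMap_tauMap, splitIP_smul_right,
    splitIP_sub_right, splitIP_smul_right]

lemma splitIP_untwist_self {u v : (Fin n → ℝ) × (Fin n → ℝ)} (hu : splitIP u u = 1)
    (hv : splitIP v v = 1) : splitIP (untwist u v) (untwist u v) = 1 := by
  have hc := (Real.cosh_pos (Real.arsinh (splitIP u (tauMap v)))).ne'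
  have hsq := Real.cosh_sq (Real.arsinh (splitIP u (tauMap v)))
  rw [Real.sinh_arsinh] at hsq
  rw [splitIP_untwist_left, splitIP_tauMap_untwist, splitIP_comm v (untwist u v),
    splitIP_untwist_left, hu, hv]
  field_simp
  linarith

lemma cosh_smul_untwist_add (u v : (Fin n → ℝ) × (Fin n → ℝ)) :
    Real.cosh (Real.arsinh (splitIP u (tauMap v))) • untwist u v +
      Real.sinh (Real.arsinh (splitIP u (tauMap v))) • tauMap u = v := by
  rw [untwist, smul_inv_smul₀ (Real.cosh_pos _).ne', Real.sinh_arsinh, sub_add_cancel]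

lemma unitaryFrame_spec {ε : ℕ → (Fin n → ℝ) × (Fin n → ℝ)} {m : ℕ}
    (hon : ∀ i < m, ∀ j < m, splitIP (ε i) (ε j) = if i = j then 1 else 0)
    (hblock : ∀ i < m, ∀ j < m, i / 2 ≠ j / 2 → splitIP (ε i) (tauMap (ε j)) = 0)
    {i j : ℕ} (hi : i < m) (hj : j < m) :
    splitIP (unitaryFrame ε i) (unitaryFrame ε j) = (if i = j then 1 else 0) ∧
      splitIP (unitaryFrame ε i) (tauMap (unitaryFrame ε j)) = 0 := by
  have even_odd : ∀ a b, 2 * a < m → 2 * b + 1 < m →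
      splitIP (ε (2 * a)) (untwist (ε (2 * b)) (ε (2 * b + 1))) = 0 ∧
        splitIP (ε (2 * a)) (tauMap (untwist (ε (2 * b)) (ε (2 * b + 1)))) = 0 := by
    intro a b ha hb
    rw [splitIP_comm, splitIP_untwist_left, splitIP_tauMap_untwist,
      hon _ hb _ ha, hon _ ha _ (by omega), if_neg (by omega)]
    rcases eq_or_ne a b with rfl | hab
    · simp [splitIP_tauMap_self]
    · rw [hblock _ (by omega : 2 * b < m) _ ha (by omega), hblock _ ha _ hb (by omega),
        if_neg (by omega)]
      simp
  obtain ⟨a, rfl | rfl⟩ := Nat.even_or_odd' i <;> obtain ⟨b, rfl | rfl⟩ := Nat.even_or_odd' j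
  · simp only [unitaryFrame_even]
    refine ⟨hon _ hi _ hj, ?_⟩
    rcases eq_or_ne a b with rfl | hab
    · exact splitIP_tauMap_self _
    · exact hblock _ hi _ hj (by omega)
  · rw [unitaryFrame_even, unitaryFrame_odd, if_neg (by omega)]
    exact even_odd a b hi hj
  · rw [unitaryFrame_even, unitaryFrame_odd, if_neg (by omega), splitIP_comm,
      splitIP_tauMap_comm, neg_eq_zero]
    exact even_odd b a hj hi
  · simp only [unitaryFrame_odd]
    rcases eq_or_ne a b with rfl | hab
    · rw [if_pos rfl]
      exact ⟨splitIP_untwist_self ((hon _ (by omega) _ (by omega)).trans (if_pos rfl))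
        ((hon _ hi _ hi).trans (if_pos rfl)), splitIP_tauMap_self _⟩
    · rw [splitIP_untwist_left, splitIP_untwist_left, tauMap_tauMap,
        (even_odd a b (by omega) hj).1, (even_odd a b (by omega) hj).2,
        splitIP_tauMap_untwist, splitIP_comm (ε (2 * a + 1)) (untwist _ _),
        splitIP_untwist_left, hon _ hj _ hi, hblock _ (by omega : 2 * b < m) _ hi (by omega),
        hblock _ hi _ hj (by omega), hon _ hi _ (by omega), if_neg (by omega),
        if_neg (by omega), if_neg (by omega)]
      simp

end Split

/-- **Proposition A.2 (Canonical Form)** of Harvey–Lawson, "Split Special Lagrangian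
Geometry": every space-like `n`-plane `P` in `D^n` admits a space-like `D`-unitary
basis `e₁,…,e_n` (with `⟨e_i,e_j⟩ = δ_ij` and `⟨e_i, Te_j⟩ = 0`) and angles
`θ₁ ≥ … ≥ θ_m ≥ 0`, `m = ⌊n/2⌋`, such that the vectors `ε_{2j−1} = e_{2j−1}`,
`ε_{2j} = cosh(θ_j) e_{2j} + sinh(θ_j) T e_{2j−1}` (and `ε_n = e_n` for `n` odd) form a
basis of `P` which is orthonormal for the split inner product. -/
theorem canonical_form_spacelike_plane (n : ℕ)
    (P : Submodule ℝ ((Fin n → ℝ) × (Fin n → ℝ)))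
    (hdim : Module.finrank ℝ P = n)
    (hpos : ∀ v ∈ P, v ≠ 0 → 0 < splitIP v v) :
    ∃ (e : Fin n → (Fin n → ℝ) × (Fin n → ℝ)) (θ : Fin (n / 2) → ℝ),
      (∀ i j, splitIP (e i) (e j) = if i = j then 1 else 0) ∧
      (∀ i j, splitIP (e i) (tauMap (e j)) = 0) ∧
      (∀ j k : Fin (n / 2), j ≤ k → θ k ≤ θ j) ∧
      (∀ j, 0 ≤ θ j) ∧
      ∃ ε : Fin n → (Fin n → ℝ) × (Fin n → ℝ),
        (∀ i : Fin n, i.val % 2 = 0 → ε i = e i) ∧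
        (∀ j : Fin (n / 2),
          ε ⟨2 * j.val + 1, by have := j.isLt; omega⟩ =
            Real.cosh (θ j) • e ⟨2 * j.val + 1, by have := j.isLt; omega⟩ +
              Real.sinh (θ j) • tauMap (e ⟨2 * j.val, by have := j.isLt; omega⟩)) ∧
        (∀ i j, splitIP (ε i) (ε j) = if i = j then 1 else 0) ∧
        LinearIndependent ℝ ε ∧
        Submodule.span ℝ (Set.range ε) = P := by
  obtain ⟨ε, hmem, hon, hblock, hnonneg, hanti⟩ := exists_split_frame P hdim hpos
  have hli : LinearIndependent ℝ fun i : Fin n => ε i :=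
    linearIndependent_of_splitIP fun i j => by simp [hon i i.2 j j.2, Fin.ext_iff]
  refine ⟨fun i => unitaryFrame ε i,
    fun j => Real.arsinh (splitIP (ε (2 * j)) (tauMap (ε (2 * j + 1)))),
    fun i j => ?_, fun i j => (unitaryFrame_spec hon hblock i.2 j.2).2, fun j k hjk => ?_,
    fun j => ?_, fun i => ε i, fun i hi => ?_, fun j => ?_, fun i j => ?_, hli, ?_⟩
  · simpa only [Fin.ext_iff] using (unitaryFrame_spec hon hblock i.2 j.2).1
  · exact Real.arsinh_le_arsinh.2 (hanti j k hjk (by omega))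
  · exact Real.arsinh_nonneg_iff.2 (hnonneg j (by omega))
  · simp [unitaryFrame, hi]
  · simp only [unitaryFrame_odd, unitaryFrame_even, cosh_smul_untwist_add]
  · simpa only [Fin.ext_iff] using hon i i.2 j j.2
  · refine Submodule.eq_of_le_of_finrank_eq (Submodule.span_le.2 ?_) ?_
    · rintro _ ⟨i, rfl⟩
      exact hmem i i.2
    · rw [finrank_span_eq_card hli, Fintype.card_fin, hdim]
end

section
/- Let 1 ≤ p ≤ q and equip V = ℝ^p × ℝ^q with the split bilinear form b((x,y),(x',y')) = x⋅x' − y⋅y'. In the p-th exterior power Λ^p V define: G = the set of wedges v₁∧…∧v_p where b(v_i, v_j) = δ_ij for all i,j and the p×p matrix whose columns are the ℝ^p-components of v₁,…,v_p has positive determinant; and I = the set of wedges (e₁, Ae₁)∧…∧(e_p, Ae_p) where e₁,…,e_p is the standard basis of ℝ^p and A : ℝ^p → ℝ^q is a linear isometry (AᵀA = I). Then the topological closure of the set of all finite nonnegative linear combinations of elements of G equals the set of all finite nonnegative linear combinations of elements of I. -/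
open Matrix

/-- The split bilinear form on `ℝ^p × ℝ^q`: `b((x,y),(x',y')) = x⋅x' − y⋅y'`. -/
def splitB {p q : ℕ} (v w : (Fin p → ℝ) × (Fin q → ℝ)) : ℝ :=
  v.1 ⬝ᵥ w.1 - v.2 ⬝ᵥ w.2

/-- The coordinates of a vector of `ℝ^p × ℝ^q` as a vector of `ℝ^{p+q}`. -/
def splitCoords {p q : ℕ} (v : (Fin p → ℝ) × (Fin q → ℝ)) : Fin (p + q) → ℝ :=
  fun i => Sum.elim v.1 v.2 (finSumFinEquiv.symm i)

/-- The wedge `v₁ ∧ … ∧ v_p ∈ Λ^p(ℝ^{p+q})` of a `p`-tuple of vectors of `ℝ^p × ℝ^q`,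
written in Plücker coordinates: the family of its `p × p` minors, indexed by the
`p`-element subsets of the `p + q` coordinates. -/
noncomputable def wedgeCoords {p q : ℕ} (v : Fin p → (Fin p → ℝ) × (Fin q → ℝ)) :
    Finset (Fin (p + q)) → ℝ := fun s =>
  if h : s.card = p then
    (Matrix.of fun i j : Fin p => splitCoords (v j) ((s.orderIsoOfFin h i : Fin (p + q)))).det
  else 0

/-- The set of finite nonnegative linear combinations of elements of `S`
(the convex cone on `S`). -/
def nonnegCombos {E : Type*} [AddCommMonoid E] [SMul ℝ E] (S : Set E) : Set E :=
  {x | ∃ (k : ℕ) (c : Fin k → ℝ) (g : Fin k → E),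
    (∀ i, 0 ≤ c i) ∧ (∀ i, g i ∈ S) ∧ x = ∑ i, c i • g i}

theorem nonnegCombos_eq_hull {E : Type*} [AddCommMonoid E] [Module ℝ E] (S : Set E) :
    nonnegCombos S = (PointedCone.hull ℝ S : Set E) := by
  ext x
  simp only [nonnegCombos, Set.mem_ofPred_eq, SetLike.mem_coe, PointedCone.hull,
    Submodule.mem_span_set']
  constructor
  · rintro ⟨k, c, g, hc, hg, rfl⟩
    exact ⟨k, fun i => ⟨c i, hc i⟩, fun i => ⟨g i, hg i⟩, rfl⟩
  · rintro ⟨k, c, g, rfl⟩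
    exact ⟨k, fun i => c i, fun i => g i, fun i => (c i).2, fun i => (g i).2, rfl⟩

/-- In a finite-dimensional space the convex hull of a compact set is compact. -/
theorem IsCompact.convexHull_of_finiteDimensional {E : Type*} [NormedAddCommGroup E]
    [NormedSpace ℝ E] [FiniteDimensional ℝ E] {S : Set E} (hS : IsCompact S) :
    IsCompact (convexHull ℝ S) := by
  classical
  rcases S.eq_empty_or_nonempty with rfl | ⟨s₀, hs₀⟩
  · simp
  set n := Module.finrank ℝ E + 1
  have hcomp : IsCompact ((fun z : (Fin n → ℝ) × (Fin n → E) => ∑ i, z.1 i • z.2 i) ''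
      (stdSimplex ℝ (Fin n) ×ˢ Set.univ.pi fun _ => S)) :=
    ((isCompact_stdSimplex ℝ (Fin n)).prod (isCompact_univ_pi fun _ => hS)).image (by fun_prop)
  convert hcomp
  apply Set.Subset.antisymm
  · intro x hx
    obtain ⟨ι, _, z, w, hz, hind, hw, hw1, rfl⟩ := eq_pos_convex_span_of_mem_convexHull hx
    have hcard : Fintype.card ι ≤ Fintype.card (Fin n) := by
      simpa [n] using hind.card_le_finrank_succ.trans
        (Nat.succ_le_succ (Submodule.finrank_le _))
    obtain ⟨e⟩ := Function.Embedding.nonempty_of_card_le hcard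
    refine ⟨(Function.extend e w 0, Function.extend e z fun _ => s₀), ⟨⟨?_, ?_⟩, ?_⟩, ?_⟩
    · intro j
      by_cases hj : ∃ i, e i = j
      · obtain ⟨i, rfl⟩ := hj
        simpa [e.injective.extend_apply] using (hw i).le
      · simp [Function.extend_apply' _ _ _ hj]
    · rw [← hw1]
      exact (Fintype.sum_of_injective e e.injective w (Function.extend e w 0)
        (fun j hj => Function.extend_apply' _ _ _ hj)
        (fun i => (e.injective.extend_apply _ _ _).symm)).symm
    · intro j _
      by_cases hj : ∃ i, e i = j
      · obtain ⟨i, rfl⟩ := hj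
        simpa [e.injective.extend_apply] using hz ⟨i, rfl⟩
      · simpa [Function.extend_apply' _ _ _ hj] using hs₀
    · refine (Fintype.sum_of_injective e e.injective _ _ (fun j hj => ?_) (fun i => ?_)).symm
      · simp [Function.extend_apply' _ _ _ hj]
      · simp [e.injective.extend_apply]
  · rintro _ ⟨⟨w, z⟩, ⟨⟨hw, hw1⟩, hz⟩, rfl⟩
    exact (convex_convexHull ℝ S).sum_mem (fun i _ => hw i) hw1
      fun i _ => subset_convexHull ℝ S (hz i trivial)

/-- The cone on a compact set lying in an affine hyperplane off the origin is closed. -/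
theorem IsCompact.isClosed_hull {E : Type*} [NormedAddCommGroup E]
    [NormedSpace ℝ E] [FiniteDimensional ℝ E] {S : Set E} (hS : IsCompact S)
    (hne : S.Nonempty) (φ : E →L[ℝ] ℝ) (hφ : ∀ x ∈ S, φ x = 1) :
    IsClosed (PointedCone.hull ℝ S : Set E) := by
  have hφ' : ∀ y ∈ convexHull ℝ S, φ y = 1 := fun y hy =>
    convexHull_min (t := {y | φ y = 1}) hφ
      (convex_hyperplane φ.toLinearMap.isLinear 1) hy
  have hsub : convexHull ℝ S ⊆ PointedCone.hull ℝ S :=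
    convexHull_min Submodule.subset_span (PointedCone.convex _)
  have := isCompact_iff_compactSpace.1 hS.convexHull_of_finiteDimensional
  have hclosed : IsClosed {z : E × convexHull ℝ S | z.1 = φ z.1 • (z.2 : E) ∧ 0 ≤ φ z.1} :=
    (isClosed_eq (f := fun z : E × convexHull ℝ S => z.1) (by fun_prop) (by fun_prop)).inter
      (isClosed_le (f := fun _ : E × convexHull ℝ S => (0 : ℝ)) (by fun_prop) (by fun_prop))
  convert isClosedMap_fst_of_compactSpace _ hclosed
  ext x
  constructor
  · intro hx
    induction hx using Submodule.span_induction with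
    | mem x hx => exact ⟨(x, ⟨x, subset_convexHull ℝ S hx⟩), by simp [hφ x hx], rfl⟩
    | zero =>
      obtain ⟨y, hy⟩ := hne
      exact ⟨(0, ⟨y, subset_convexHull ℝ S hy⟩), by simp, rfl⟩
    | smul a x _ ih =>
      obtain ⟨⟨x, y⟩, ⟨h1, h2⟩, rfl⟩ := ih
      refine ⟨(a • x, y), ⟨?_, ?_⟩, rfl⟩
      · have : φ (a • x) = (a : ℝ) * φ x := map_smul φ (a : ℝ) x
        simp only [this, mul_smul] at h1 ⊢
        rw [← h1]
        rfl
      · exact (map_smul φ (a : ℝ) x).symm ▸ mul_nonneg a.2 h2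
    | add x x' _ _ ih ih' =>
      obtain ⟨⟨x, y⟩, ⟨h1, h2⟩, rfl⟩ := ih
      obtain ⟨⟨x', y'⟩, ⟨h1', h2'⟩, rfl⟩ := ih'
      simp only at h1 h2 h1' h2' ⊢
      rcases (add_nonneg h2 h2').eq_or_lt with h0 | hpos
      · have e1 : φ x = 0 := by linarith
        have e2 : φ x' = 0 := by linarith
        refine ⟨(x + x', y), ⟨?_, by simp [e1, e2]⟩, rfl⟩
        rw [h1, h1', e1, e2]; simp
      · refine ⟨(x + x', ⟨(φ x / (φ x + φ x')) • y + (φ x' / (φ x + φ x')) • y',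
          convex_convexHull ℝ S y.2 y'.2 (by positivity) (by positivity) (by field_simp)⟩),
          ⟨?_, by simpa using hpos.le⟩, rfl⟩
        simp only [map_add, smul_add, smul_smul, mul_div_cancel₀ _ hpos.ne']
        rw [← h1, ← h1']
  · rintro ⟨⟨x, y⟩, ⟨h1, h2⟩, rfl⟩
    exact Set.mem_of_eq_of_mem h1
      ((PointedCone.hull ℝ S).smul_mem h2 (hsub y.2))

/-- A `q × p` matrix with orthogonal columns, `p ≤ q`, is a matrix with orthonormal columns
times a diagonal matrix. -/
theorem Matrix.exists_eq_mul_diagonal_of_transpose_mul_self {p q : ℕ} (hpq : p ≤ q)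
    (X : Matrix (Fin q) (Fin p) ℝ) (d : Fin p → ℝ) (hX : Xᵀ * X = diagonal d) :
    ∃ n : Matrix (Fin q) (Fin p) ℝ, nᵀ * n = 1 ∧ X = n * diagonal fun i => √(d i) := by
  let c : Fin p → EuclideanSpace ℝ (Fin q) := fun i => WithLp.toLp 2 (Xᵀ i)
  have hc : ∀ i j, inner ℝ (c i) (c j) = if i = j then d i else 0 := by
    intro i j
    rw [← diagonal_apply, ← hX]
    simp [c, PiLp.inner_apply, mul_apply, mul_comm]
  have hd : ∀ i, 0 ≤ d i := fun i => by
    have := hc i i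
    rw [if_pos rfl] at this
    exact this ▸ real_inner_self_nonneg
  let e : Fin p ↪ Fin q := Fin.castLEEmb hpq
  let v : Fin q → EuclideanSpace ℝ (Fin q) := Function.extend e (fun i => (√(d i))⁻¹ • c i) 0
  have hv : ∀ i, v (e i) = (√(d i))⁻¹ • c i := fun i => e.injective.extend_apply _ _ _
  have horth : Orthonormal ℝ ((e '' {i | d i ≠ 0}).domRestrict v) := by
    rw [orthonormal_iff_ite]
    rintro ⟨_, i, hi, rfl⟩ ⟨_, j, hj, rfl⟩
    by_cases h : i = j
    · subst h
      have : √(d i) ≠ 0 := (Real.sqrt_ne_zero (hd i)).2 hi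
      have h2 := Real.mul_self_sqrt (hd i)
      simp only [Set.domRestrict_apply, hv, inner_smul_left, inner_smul_right, hc, if_true,
        conj_trivial]
      field_simp
      linarith
    · refine Eq.trans ?_ (if_neg fun h' => h (e.injective (Subtype.ext_iff.1 h'))).symm
      simp [Set.domRestrict_apply, hv, inner_smul_left, inner_smul_right, hc, h]
  obtain ⟨b, hb⟩ := horth.exists_orthonormalBasis_extension_of_card_eq (by simp)
  refine ⟨of fun k i => b (e i) k, ?_, ?_⟩
  · ext i j
    have := orthonormal_iff_ite.1 b.orthonormal (e i) (e j)
    simp only [e.injective.eq_iff] at this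
    rw [one_apply, ← this]
    simp [PiLp.inner_apply, mul_apply, mul_comm]
  · ext k i
    rw [mul_diagonal, of_apply]
    have hck : X k i = c i k := rfl
    by_cases h : d i = 0
    · have : c i = 0 := by
        rw [← inner_self_eq_zero (𝕜 := ℝ), hc, if_pos rfl, h]
      rw [hck, this, h]; simp
    · rw [hb (e i) ⟨i, h, rfl⟩, hv, hck]
      have : √(d i) ≠ 0 := (Real.sqrt_ne_zero (hd i)).2 h
      simp only [PiLp.smul_apply, smul_eq_mul]
      field_simp

/-- A Gram matrix is diagonalised by an orthogonal matrix. -/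
theorem Matrix.exists_orthogonal_transpose_mul_mul_eq_diagonal {m n : Type*} [Fintype m]
    [Fintype n] [DecidableEq n] (N : Matrix m n ℝ) :
    ∃ (V : Matrix n n ℝ) (d : n → ℝ), Vᵀ * V = 1 ∧ (∀ i, 0 ≤ d i) ∧
      (N * V)ᵀ * (N * V) = diagonal d := by
  have hN : (Nᵀ * N).PosSemidef := by
    simpa [conjTranspose_eq_transpose_of_trivial] using posSemidef_conjTranspose_mul_self N
  refine ⟨hN.1.eigenvectorUnitary, hN.1.eigenvalues, ?_, hN.eigenvalues_nonneg, ?_⟩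
  · simpa [star_eq_conjTranspose, conjTranspose_eq_transpose_of_trivial] using
      Unitary.coe_star_mul_self hN.1.eigenvectorUnitary
  · have := hN.1.conjStarAlgAut_star_eigenvectorUnitary
    rw [Unitary.conjStarAlgAut_star_apply] at this
    simpa [star_eq_conjTranspose, conjTranspose_eq_transpose_of_trivial, Matrix.mul_assoc,
      transpose_mul, Function.comp_def] using this

/-- The coordinate map `splitCoords` as a linear map. -/
def splitCoordsLinearMap (p q : ℕ) :
    ((Fin p → ℝ) × (Fin q → ℝ)) →ₗ[ℝ] (Fin (p + q) → ℝ) where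
  toFun := splitCoords
  map_add' v w := by
    ext i
    simp only [splitCoords, Pi.add_apply]
    cases finSumFinEquiv.symm i <;> simp
  map_smul' c v := by
    ext i
    simp only [splitCoords, Pi.smul_apply]
    cases finSumFinEquiv.symm i <;> simp

/-- The wedge in Plücker coordinates as a multilinear map. -/
noncomputable def wedgeMultilinear (p q : ℕ) :
    MultilinearMap ℝ (fun _ : Fin p => (Fin p → ℝ) × (Fin q → ℝ))
      (Finset (Fin (p + q)) → ℝ) :=
  MultilinearMap.pi fun s =>
    if h : s.card = p then
      (detRowAlternating (n := Fin p) (R := ℝ)).toMultilinearMap.compLinearMap fun _ =>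
        (LinearMap.funLeft ℝ ℝ fun i => (s.orderIsoOfFin h i : Fin (p + q))) ∘ₗ
          splitCoordsLinearMap p q
    else 0

theorem wedgeMultilinear_apply {p q : ℕ} (v : Fin p → (Fin p → ℝ) × (Fin q → ℝ)) :
    wedgeMultilinear p q v = wedgeCoords v := by
  ext s
  simp only [wedgeMultilinear, wedgeCoords, MultilinearMap.pi_apply]
  split_ifs with h
  · rw [← det_transpose]
    rfl
  · rfl

/-- The tuple of vectors of `ℝ^p × ℝ^q` whose components are the columns of `M` and `N`. -/
def splitFrame {p q : ℕ} (M : Matrix (Fin p) (Fin p) ℝ) (N : Matrix (Fin q) (Fin p) ℝ) :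
    Fin p → (Fin p → ℝ) × (Fin q → ℝ) :=
  fun j => (Mᵀ j, Nᵀ j)

theorem wedgeCoords_splitFrame_mul {p q : ℕ} (M C : Matrix (Fin p) (Fin p) ℝ)
    (N : Matrix (Fin q) (Fin p) ℝ) :
    wedgeCoords (splitFrame (M * C) (N * C)) = C.det • wedgeCoords (splitFrame M N) := by
  ext s
  simp only [wedgeCoords, Pi.smul_apply, smul_eq_mul]
  split_ifs with h
  · rw [mul_comm, ← det_mul]
    congr 1
    ext i j
    simp only [mul_apply, of_apply, splitCoords, splitFrame]
    cases finSumFinEquiv.symm (s.orderIsoOfFin h i : Fin (p + q)) <;>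
      simp [mul_apply, mul_comm]
  · simp

theorem continuous_wedgeCoords {p q : ℕ} :
    Continuous (wedgeCoords : (Fin p → (Fin p → ℝ) × (Fin q → ℝ)) → _) := by
  refine continuous_pi fun s => ?_
  simp only [wedgeCoords]
  split_ifs with h
  · refine Continuous.matrix_det (continuous_pi fun i => continuous_pi fun j => ?_)
    exact (continuous_apply (s.orderIsoOfFin h i : Fin (p + q))).comp
      ((splitCoordsLinearMap p q).continuous_of_finiteDimensional.comp (continuous_apply j))
  · fun_prop

theorem continuous_wedgeCoords_splitFrame_one {p q : ℕ} :
    Continuous fun A : Matrix (Fin q) (Fin p) ℝ => wedgeCoords (splitFrame 1 A) :=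
  continuous_wedgeCoords.comp (by unfold splitFrame; fun_prop)

/-- The set of wedges of graphs of linear isometries. -/
def isometryWedges (p q : ℕ) : Set (Finset (Fin (p + q)) → ℝ) :=
  {x | ∃ A : Matrix (Fin q) (Fin p) ℝ, Aᵀ * A = 1 ∧ x = wedgeCoords (splitFrame 1 A)}

/-- The set of wedges of positively oriented space-like orthonormal frames. -/
def spaceLikeWedges (p q : ℕ) : Set (Finset (Fin (p + q)) → ℝ) :=
  {x | ∃ (M : Matrix (Fin p) (Fin p) ℝ) (N : Matrix (Fin q) (Fin p) ℝ),
    Mᵀ * M - Nᵀ * N = 1 ∧ 0 < M.det ∧ x = wedgeCoords (splitFrame M N)}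

theorem isCompact_setOf_transpose_mul_self_eq_one (m n : Type*) [Fintype m] [Fintype n]
    [DecidableEq n] : IsCompact {A : Matrix m n ℝ | Aᵀ * A = 1} := by
  have hbox : IsCompact (X := Matrix m n ℝ) (Set.univ.pi fun _ : m => Set.univ.pi fun _ : n =>
      Set.Icc (-1 : ℝ) 1) := isCompact_univ_pi fun _ => isCompact_univ_pi fun _ => isCompact_Icc
  refine hbox.of_isClosed_subset (isClosed_eq (f := fun A : Matrix m n ℝ => Aᵀ * A)
    (by fun_prop) continuous_const) ?_
  intro A hA k _ i _
  have h1 : ∑ l, A l i * A l i = 1 := by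
    simpa [mul_apply] using congrFun (congrFun (show Aᵀ * A = 1 from hA) i) i
  have h2 : A k i * A k i ≤ 1 :=
    h1 ▸ Finset.single_le_sum (f := fun l => A l i * A l i)
      (fun l _ => mul_self_nonneg _) (Finset.mem_univ k)
  exact abs_le.1 (abs_le_one_iff_mul_self_le_one.2 h2)

theorem isCompact_isometryWedges (p q : ℕ) : IsCompact (isometryWedges p q) := by
  convert (isCompact_setOf_transpose_mul_self_eq_one (Fin q) (Fin p)).image
    continuous_wedgeCoords_splitFrame_one
  ext x
  exact exists_congr fun A => and_congr_right fun _ => eq_comm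

theorem isometryWedges_nonempty {p q : ℕ} (hpq : p ≤ q) : (isometryWedges p q).Nonempty := by
  obtain ⟨A, hA, -⟩ := exists_eq_mul_diagonal_of_transpose_mul_self hpq 0 0 (by simp)
  exact ⟨_, A, hA, rfl⟩

theorem wedgeCoords_splitFrame_apply_univ_map_castAddEmb {p q : ℕ}
    (M : Matrix (Fin p) (Fin p) ℝ) (N : Matrix (Fin q) (Fin p) ℝ) :
    wedgeCoords (splitFrame M N) (Finset.univ.map (Fin.castAddEmb q)) = M.det := by
  have hcard : (Finset.univ.map (Fin.castAddEmb q : Fin p ↪ Fin (p + q))).card = p := by simp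
  have hemb : ∀ i, ((Finset.univ.map (Fin.castAddEmb q)).orderIsoOfFin hcard i : Fin (p + q)) =
      Fin.castAdd q i := fun i =>
    (congrFun (Finset.orderEmbOfFin_unique hcard (f := Fin.castAdd q) (by simp)
      (Fin.strictMono_castAdd q)) i).symm
  rw [wedgeCoords, dif_pos hcard]
  congr 1
  ext i j
  simp [hemb, splitCoords, splitFrame]

theorem isClosed_hull_isometryWedges {p q : ℕ} (hpq : p ≤ q) :
    IsClosed (PointedCone.hull ℝ (isometryWedges p q) :
      Set (Finset (Fin (p + q)) → ℝ)) := by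
  refine (isCompact_isometryWedges p q).isClosed_hull (isometryWedges_nonempty hpq)
    (ContinuousLinearMap.proj (Finset.univ.map (Fin.castAddEmb q))) ?_
  rintro _ ⟨A, -, rfl⟩
  simp [wedgeCoords_splitFrame_apply_univ_map_castAddEmb]

theorem wedgeCoords_splitFrame_of_orthogonal {p q : ℕ} (m : Matrix (Fin p) (Fin p) ℝ)
    (n : Matrix (Fin q) (Fin p) ℝ) (hm : mᵀ * m = 1) (hn : nᵀ * n = 1) :
    ∃ x ∈ isometryWedges p q, wedgeCoords (splitFrame m n) = m.det • x := by
  refine ⟨_, ⟨n * mᵀ, ?_, rfl⟩, ?_⟩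
  · rw [transpose_mul, transpose_transpose, Matrix.mul_assoc, ← Matrix.mul_assoc nᵀ, hn,
      Matrix.one_mul, mul_eq_one_comm.1 hm]
  · rw [← wedgeCoords_splitFrame_mul, Matrix.one_mul, Matrix.mul_assoc, hm, Matrix.mul_one]

/-- Writing `(aⱼ mⱼ, bⱼ nⱼ)` as a nonnegative combination of the null vectors `(mⱼ, ± nⱼ)` and
expanding the wedge multilinearly. -/
theorem smul_wedgeCoords_mul_diagonal_mem_hull {p q : ℕ} (m : Matrix (Fin p) (Fin p) ℝ)
    (n : Matrix (Fin q) (Fin p) ℝ) (hm : mᵀ * m = 1) (hn : nᵀ * n = 1) (a b : Fin p → ℝ)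
    (hb : ∀ j, 0 ≤ b j) (hab : ∀ j, b j ≤ a j) (t : ℝ) (ht : 0 ≤ t * m.det) :
    t • wedgeCoords (splitFrame (m * diagonal a) (n * diagonal b)) ∈
      PointedCone.hull ℝ (isometryWedges p q) := by
  let ε : Bool → ℝ := fun s => if s then 1 else -1
  let c : Fin p → Bool → ℝ := fun j s => (a j + ε s * b j) / 2
  have hc : ∀ j s, 0 ≤ c j s := by
    intro j s
    have := hb j
    have := hab j
    cases s <;> simp [c, ε] <;> linarith
  have hsplit : splitFrame (m * diagonal a) (n * diagonal b) =
      fun j => ∑ s, c j s • ((mᵀ j, ε s • nᵀ j) : (Fin p → ℝ) × (Fin q → ℝ)) := by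
    ext j k
    · simp [splitFrame, c, ε]; ring
    · simp [splitFrame, c, ε]; ring
  rw [hsplit, ← wedgeMultilinear_apply, MultilinearMap.map_sum, Finset.smul_sum]
  refine Submodule.sum_mem _ fun r _ => ?_
  rw [MultilinearMap.map_smul_univ, wedgeMultilinear_apply]
  have hframe : (fun j => ((mᵀ j, ε (r j) • nᵀ j) : (Fin p → ℝ) × (Fin q → ℝ))) =
      splitFrame m (n * diagonal fun j => ε (r j)) := by
    ext j k <;> simp [splitFrame, mul_comm]
  have hε : (n * diagonal fun j => ε (r j))ᵀ * (n * diagonal fun j => ε (r j)) = 1 := by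
    rw [transpose_mul, diagonal_transpose, Matrix.mul_assoc, ← Matrix.mul_assoc nᵀ, hn,
      Matrix.one_mul, diagonal_mul_diagonal, ← diagonal_one]
    congr 1
    ext j
    cases h : r j <;> simp [ε]
  obtain ⟨x, hx, hxe⟩ := wedgeCoords_splitFrame_of_orthogonal m _ hm hε
  rw [hframe, hxe, smul_smul, smul_smul]
  have hnonneg : 0 ≤ t * (∏ j, c j (r j)) * m.det := by
    rw [mul_right_comm]
    exact mul_nonneg ht (Finset.prod_nonneg fun j _ => hc j _)
  exact Submodule.smul_mem _ (⟨_, hnonneg⟩ : {c : ℝ // 0 ≤ c}) (Submodule.subset_span hx)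

theorem spaceLikeWedges_subset_hull {p q : ℕ} (hpq : p ≤ q) :
    spaceLikeWedges p q ⊆ PointedCone.hull ℝ (isometryWedges p q) := by
  rintro _ ⟨M, N, hMN, hdet, rfl⟩
  obtain ⟨V, d, hV, hd, hNV⟩ := N.exists_orthogonal_transpose_mul_mul_eq_diagonal
  have hMV : (M * V)ᵀ * (M * V) = diagonal fun i => 1 + d i := by
    have hM : Mᵀ * M = 1 + Nᵀ * N := sub_eq_iff_eq_add.1 hMN
    calc (M * V)ᵀ * (M * V) = Vᵀ * (Mᵀ * M) * V := by
          simp only [transpose_mul, Matrix.mul_assoc]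
      _ = Vᵀ * V + (N * V)ᵀ * (N * V) := by
          rw [hM, Matrix.mul_add, Matrix.add_mul, Matrix.mul_one]
          simp only [transpose_mul, Matrix.mul_assoc]
      _ = diagonal fun i => 1 + d i := by rw [hV, hNV, ← diagonal_one, diagonal_add]
  obtain ⟨m, hm, hMm⟩ := exists_eq_mul_diagonal_of_transpose_mul_self le_rfl _ _ hMV
  obtain ⟨n, hn, hNn⟩ := exists_eq_mul_diagonal_of_transpose_mul_self hpq _ _ hNV
  have hV2 : V.det * V.det = 1 := by simpa using congrArg det hV
  have hpos : 0 < ∏ i, √(1 + d i) :=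
    Finset.prod_pos fun i _ => Real.sqrt_pos.2 (by linarith [hd i])
  have hdet' : M.det * V.det = m.det * ∏ i, √(1 + d i) := by
    simpa using congrArg det hMm
  have hsign : 0 ≤ V.det * m.det := by
    refine nonneg_of_mul_nonneg_left ?_ hpos
    calc 0 ≤ M.det * (V.det * V.det) := by rw [hV2, mul_one]; exact hdet.le
      _ = V.det * m.det * ∏ i, √(1 + d i) := by linear_combination V.det * hdet'
  have hmem := smul_wedgeCoords_mul_diagonal_mem_hull m n hm hn (fun i => √(1 + d i))
    (fun i => √(d i)) (fun i => Real.sqrt_nonneg _)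
    (fun i => Real.sqrt_le_sqrt (by linarith)) V.det hsign
  rwa [← hMm, ← hNn, wedgeCoords_splitFrame_mul, smul_smul, hV2, one_smul] at hmem

theorem isometryWedges_subset_closure (p q : ℕ) :
    isometryWedges p q ⊆ closure (PointedCone.hull ℝ (spaceLikeWedges p q)) := by
  rintro _ ⟨A, hA, rfl⟩
  have hcont : Continuous fun t : ℝ => wedgeCoords (splitFrame 1 (t • A)) :=
    continuous_wedgeCoords_splitFrame_one.comp (by fun_prop)
  have hlim : Filter.Tendsto (fun t : ℝ => wedgeCoords (splitFrame 1 (t • A)))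
      (nhdsWithin 1 (Set.Iio 1)) (nhds (wedgeCoords (splitFrame 1 A))) := by
    have := (hcont.tendsto 1).mono_left (nhdsWithin_le_nhds (s := Set.Iio 1))
    rwa [one_smul] at this
  refine mem_closure_of_tendsto hlim ?_
  filter_upwards [Ioo_mem_nhdsLT (show (0 : ℝ) < 1 by norm_num)] with t ht
  have h1 : 0 < 1 - t ^ 2 := by nlinarith [ht.1, ht.2]
  set s := √(1 - t ^ 2)
  have hs : 0 < s := Real.sqrt_pos.2 h1
  have hs2 : s * s = 1 - t ^ 2 := Real.mul_self_sqrt h1.le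
  have hmem : wedgeCoords (splitFrame (s⁻¹ • (1 : Matrix (Fin p) (Fin p) ℝ)) (s⁻¹ • t • A)) ∈
      spaceLikeWedges p q := by
    refine ⟨_, _, ?_, ?_, rfl⟩
    · simp only [transpose_smul, transpose_one, Matrix.smul_mul, Matrix.mul_smul, hA,
        Matrix.one_mul, ← sub_smul, smul_smul]
      rw [show s⁻¹ * s⁻¹ - s⁻¹ * t * (s⁻¹ * t) = 1 by
        field_simp; linarith, one_smul]
    · simp only [det_smul, det_one, mul_one]
      positivity
  have hscale : wedgeCoords (splitFrame 1 (t • A)) = (s ^ p) •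
      wedgeCoords (splitFrame (s⁻¹ • (1 : Matrix (Fin p) (Fin p) ℝ)) (s⁻¹ • t • A)) := by
    have := wedgeCoords_splitFrame_mul (s⁻¹ • (1 : Matrix (Fin p) (Fin p) ℝ)) (s • 1)
      (s⁻¹ • t • A)
    rw [det_smul, det_one, mul_one, Fintype.card_fin] at this
    rw [← this]
    simp [smul_smul, hs.ne']
  rw [hscale]
  exact Submodule.smul_mem _ (⟨s ^ p, by positivity⟩ : {c : ℝ // 0 ≤ c})
    (Submodule.subset_span hmem)

/-- **Proposition D.13** of Harvey–Lawson, "Split Special Lagrangian Geometry": for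
`1 ≤ p ≤ q`, the closed mass cone in `Λ^p(ℝ^{p,q})` — the closure of the convex cone
generated by the wedges of positively oriented space-like orthonormal `p`-frames —
equals the convex cone generated by the (totally null) wedges
`(e₁+Ae₁) ∧ … ∧ (e_p+Ae_p)` associated to linear isometries `A : ℝ^p → ℝ^q`. -/
theorem mass_cone_eq_cone_on_isometries (p q : ℕ) (hp : 1 ≤ p) (hpq : p ≤ q) :
    closure (nonnegCombos {x : Finset (Fin (p + q)) → ℝ |
        ∃ v : Fin p → (Fin p → ℝ) × (Fin q → ℝ),
          (∀ i j, splitB (v i) (v j) = if i = j then 1 else 0) ∧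
          0 < (Matrix.of fun i j : Fin p => (v j).1 i).det ∧
          x = wedgeCoords v}) =
      nonnegCombos {x : Finset (Fin (p + q)) → ℝ |
        ∃ A : Matrix (Fin q) (Fin p) ℝ, Aᵀ * A = 1 ∧
          x = wedgeCoords (fun i => ((Pi.single i 1 : Fin p → ℝ),
            A.mulVec (Pi.single i 1)))} := by
  have hG : {x : Finset (Fin (p + q)) → ℝ |
      ∃ v : Fin p → (Fin p → ℝ) × (Fin q → ℝ),
        (∀ i j, splitB (v i) (v j) = if i = j then 1 else 0) ∧
        0 < (Matrix.of fun i j : Fin p => (v j).1 i).det ∧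
        x = wedgeCoords v} = spaceLikeWedges p q := by
    ext x
    constructor
    · rintro ⟨v, hv, hdet, rfl⟩
      refine ⟨of fun i j => (v j).1 i, of fun i j => (v j).2 i, ?_, hdet, rfl⟩
      ext i j
      rw [one_apply, ← hv i j]
      simp [splitB, mul_apply, dotProduct]
    · rintro ⟨M, N, hMN, hdet, rfl⟩
      refine ⟨splitFrame M N, fun i j => ?_, hdet, rfl⟩
      rw [← one_apply, ← hMN]
      simp [splitB, splitFrame, mul_apply, dotProduct]
  have hI : {x : Finset (Fin (p + q)) → ℝ |
      ∃ A : Matrix (Fin q) (Fin p) ℝ, Aᵀ * A = 1 ∧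
        x = wedgeCoords (fun i => ((Pi.single i 1 : Fin p → ℝ),
          A.mulVec (Pi.single i 1)))} = isometryWedges p q := by
    have hframe : ∀ A : Matrix (Fin q) (Fin p) ℝ,
        (fun i => ((Pi.single i 1 : Fin p → ℝ), A.mulVec (Pi.single i 1))) =
          splitFrame 1 A := by
      intro A
      ext i k
      · simp [splitFrame, one_apply, Pi.single_apply, eq_comm]
      · simp [splitFrame]
    simp only [hframe, isometryWedges]
  rw [hG, hI, nonnegCombos_eq_hull, nonnegCombos_eq_hull]
  refine Set.Subset.antisymm (closure_minimal
    (Submodule.span_le.2 (spaceLikeWedges_subset_hull hpq)) (isClosed_hull_isometryWedges hpq)) ?_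
  rw [← PointedCone.coe_closure]
  exact Submodule.span_le.2 (isometryWedges_subset_closure p q)
end

section
/- Let P be a 2-dimensional linear subspace of ℝ⁴ with coordinates (x₁, x₂, y₁, y₂). Define the bilinear forms ω(v, w) = v_{x₁}w_{y₁} − v_{y₁}w_{x₁} + v_{x₂}w_{y₂} − v_{y₂}w_{x₂} and ψ(v, w) = v_{x₁}w_{y₂} − v_{y₂}w_{x₁} + v_{y₁}w_{x₂} − v_{x₂}w_{y₁}, and the linear map J : ℝ⁴ → ℝ⁴ by J(x₁, x₂, y₁, y₂) = (−x₂, x₁, y₂, −y₁) (so J² = −Id). Then ω and ψ both vanish identically on P if and only if J(P) = P. -/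
open Matrix

/-- The complex structure `J(x₁, x₂, y₁, y₂) = (−x₂, x₁, y₂, −y₁)` on
`ℝ⁴` (coordinates `(x₁, x₂, y₁, y₂)`), with `J² = −Id`. -/
noncomputable def Jstruct : (Fin 4 → ℝ) →ₗ[ℝ] (Fin 4 → ℝ) :=
  Matrix.mulVecLin !![0, -1, 0, 0; 1, 0, 0, 0; 0, 0, 0, 1; 0, 0, -1, 0]

theorem Jstruct_apply (v : Fin 4 → ℝ) : Jstruct v = ![-v 1, v 0, v 3, -v 2] := by
  ext i
  fin_cases i <;> simp [Jstruct, Matrix.mulVec, dotProduct, Fin.sum_univ_four]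

theorem Jstruct_Jstruct (v : Fin 4 → ℝ) : Jstruct (Jstruct v) = -v := by
  ext i
  fin_cases i <;> simp [Jstruct_apply]

theorem sum_sq_ne_zero {v : Fin 4 → ℝ} (hv : v ≠ 0) :
    v 0 ^ 2 + v 1 ^ 2 + v 2 ^ 2 + v 3 ^ 2 ≠ 0 := by
  contrapose! hv
  ext i
  fin_cases i <;> simp <;> nlinarith [sq_nonneg (v 0), sq_nonneg (v 1), sq_nonneg (v 2),
    sq_nonneg (v 3)]

/-- The forms `ω` and `ψ` are the imaginary and real parts of the complex determinant for `J`,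
so they vanish on `(v, w)` exactly when `w` lies on the complex line through `v`. -/
theorem mem_span_pair_Jstruct_iff {v : Fin 4 → ℝ} (hv : v ≠ 0) (w : Fin 4 → ℝ) :
    w ∈ Submodule.span ℝ {v, Jstruct v} ↔
      v 0 * w 2 - v 2 * w 0 + v 1 * w 3 - v 3 * w 1 = 0 ∧
      v 0 * w 3 - v 3 * w 0 + v 2 * w 1 - v 1 * w 2 = 0 := by
  rw [Submodule.mem_span_pair]
  constructor
  · rintro ⟨a, b, rfl⟩
    constructor <;> simp [Jstruct_apply] <;> ring
  · rintro ⟨hω, hψ⟩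
    have hn := sum_sq_ne_zero hv
    refine ⟨(v 0 * w 0 + v 1 * w 1 + v 2 * w 2 + v 3 * w 3) /
        (v 0 ^ 2 + v 1 ^ 2 + v 2 ^ 2 + v 3 ^ 2),
      (v 0 * w 1 - v 1 * w 0 + v 3 * w 2 - v 2 * w 3) /
        (v 0 ^ 2 + v 1 ^ 2 + v 2 ^ 2 + v 3 ^ 2), ?_⟩
    ext i
    fin_cases i <;> simp [Jstruct_apply] <;> field_simp
    · linear_combination v 2 * hω + v 3 * hψ
    · linear_combination v 3 * hω - v 2 * hψ
    · linear_combination -v 0 * hω + v 1 * hψ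
    · linear_combination -v 1 * hω - v 0 * hψ

theorem finrank_span_pair_Jstruct {v : Fin 4 → ℝ} (hv : v ≠ 0) :
    Module.finrank ℝ (Submodule.span ℝ {v, Jstruct v}) = 2 := by
  have hli : LinearIndependent ℝ ![v, Jstruct v] := by
    refine LinearIndependent.pair_iff.2 fun s t h => ?_
    have hJ : s • Jstruct v - t • v = 0 := by
      simpa [Jstruct_Jstruct, sub_eq_add_neg] using congrArg Jstruct h
    have hst : (s ^ 2 + t ^ 2) • v = 0 := by
      linear_combination (norm := module) s • h - t • hJ
    have := (smul_eq_zero.1 hst).resolve_right hv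
    constructor <;> nlinarith [sq_nonneg s, sq_nonneg t]
  rw [← Matrix.range_cons_cons_empty v (Jstruct v) ![], finrank_span_eq_card hli, Fintype.card_fin]

/-- The linear-algebra content of **Theorem F.3(a)** of Harvey–Lawson, "Split Special
Lagrangian Geometry": a `2`-plane `P ⊆ ℝ⁴` is unconstrained split special Lagrangian —
both `ω(v,w) = v_{x₁}w_{y₁} − v_{y₁}w_{x₁} + v_{x₂}w_{y₂} − v_{y₂}w_{x₂}` and
`ψ(v,w) = v_{x₁}w_{y₂} − v_{y₂}w_{x₁} + v_{y₁}w_{x₂} − v_{x₂}w_{y₁}` vanish on `P` —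
if and only if `P` is a complex line for `J`, i.e. `J(P) = P`.  Coordinates: index `0`
is `x₁`, `1` is `x₂`, `2` is `y₁`, `3` is `y₂`. -/
theorem unconstrained_splitSLAG_iff_complex_line
    (P : Submodule ℝ (Fin 4 → ℝ)) (hdim : Module.finrank ℝ P = 2) :
    (∀ v ∈ P, ∀ w ∈ P,
        v 0 * w 2 - v 2 * w 0 + v 1 * w 3 - v 3 * w 1 = 0 ∧
        v 0 * w 3 - v 3 * w 0 + v 2 * w 1 - v 1 * w 2 = 0) ↔
    P.map Jstruct = P := by
  constructor
  · intro h
    have hmem : ∀ v ∈ P, Jstruct v ∈ P := by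
      intro v hv
      rcases eq_or_ne v 0 with rfl | hv0
      · simp
      have hle : P ≤ Submodule.span ℝ {v, Jstruct v} := fun w hw =>
        (mem_span_pair_Jstruct_iff hv0 w).2 (h v hv w hw)
      rw [Submodule.eq_of_le_of_finrank_eq hle (hdim.trans (finrank_span_pair_Jstruct hv0).symm)]
      exact Submodule.subset_span (by simp)
    refine le_antisymm (Submodule.map_le_iff_le_comap.2 hmem) fun v hv => ?_
    exact ⟨-Jstruct v, P.neg_mem (hmem v hv), by simp [Jstruct_Jstruct]⟩
  · intro h v hv w hw
    rcases eq_or_ne v 0 with rfl | hv0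
    · simp
    have hJv : Jstruct v ∈ P := h ▸ Submodule.mem_map_of_mem hv
    have hle : Submodule.span ℝ {v, Jstruct v} ≤ P :=
      Submodule.span_le.2 (Set.pair_subset hv hJv)
    rw [← mem_span_pair_Jstruct_iff hv0,
      Submodule.eq_of_le_of_finrank_eq hle ((finrank_span_pair_Jstruct hv0).trans hdim.symm)]
    exact hw
end

section
/- Let P be a 2-dimensional linear subspace of ℝ⁴ = ℝ² × ℝ² with points (x, y), x = (x₁,x₂), y = (y₁,y₂). Then the following are equivalent: (a) the split inner product ⟨(x,y),(x',y')⟩ = x⋅x' − y⋅y' is positive definite on P, the symplectic form ω((x,y),(x',y')) = x⋅y' − y⋅x' vanishes on P, and the form Im dz (i.e. ψ(v,w) = v_{x₁}w_{y₂} − v_{y₂}w_{x₁} + v_{y₁}w_{x₂} − v_{x₂}w_{y₁}) vanishes on P; (b) there exist real numbers a, b with a² + b² < 1 such that P = {(x₁, x₂, a x₁ + b x₂, b x₁ − a x₂) : x₁, x₂ ∈ ℝ}, i.e. P is the graph of the symmetric trace-free matrix [[a, b],[b, −a]] with a² + b² < 1. -/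
open Matrix

/-- A subspace on which `x ⬝ᵥ x - y ⬝ᵥ y` is positive definite meets `{x = 0}` trivially. -/
lemma eq_zero_of_fst_eq_zero_of_spacelike {n : Type*} [Fintype n]
    {P : Submodule ℝ ((n → ℝ) × (n → ℝ))}
    (hpos : ∀ v ∈ P, v ≠ 0 → 0 < v.1 ⬝ᵥ v.1 - v.2 ⬝ᵥ v.2)
    {v : (n → ℝ) × (n → ℝ)} (hv : v ∈ P) (h : v.1 = 0) : v = 0 := by
  by_contra hne
  have hlt := hpos v hv hne
  have hsq : 0 ≤ v.2 ⬝ᵥ v.2 := Finset.sum_nonneg fun i _ => mul_self_nonneg (v.2 i)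
  rw [h, zero_dotProduct] at hlt
  linarith

/-- A space-like subspace of maximal dimension projects onto the first factor. -/
lemma exists_mem_fst_eq_of_spacelike {n : Type*} [Fintype n]
    {P : Submodule ℝ ((n → ℝ) × (n → ℝ))} (hdim : Module.finrank ℝ P = Fintype.card n)
    (hpos : ∀ v ∈ P, v ≠ 0 → 0 < v.1 ⬝ᵥ v.1 - v.2 ⬝ᵥ v.2) (x : n → ℝ) :
    ∃ v ∈ P, v.1 = x := by
  let f : P →ₗ[ℝ] (n → ℝ) := LinearMap.fst ℝ (n → ℝ) (n → ℝ) ∘ₗ P.subtype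
  have hinj : Function.Injective f :=
    (injective_iff_map_eq_zero f).2 fun v hv =>
      Subtype.ext (eq_zero_of_fst_eq_zero_of_spacelike hpos v.2 hv)
  have hsurj : Function.Surjective f :=
    (LinearMap.injective_iff_surjective_of_finrank_eq_finrank (by simp [hdim])).1 hinj
  obtain ⟨v, hv⟩ := hsurj x
  exact ⟨v, v.2, hv⟩

/-- The plane content of **Appendix F / Corollary F.5** of Harvey–Lawson, "Split
Special Lagrangian Geometry": a `2`-plane `P ⊆ ℝ² × ℝ² = D²` is split special
Lagrangian — the split inner product `⟨(x,y),(x',y')⟩ = x⋅x' − y⋅y'` is positive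
definite on `P`, the symplectic form `ω((x,y),(x',y')) = x⋅y' − y⋅x'` vanishes on `P`,
and the form `ψ = Im dz` (i.e. `ψ(v,w) = v_{x₁}w_{y₂} − v_{y₂}w_{x₁} + v_{y₁}w_{x₂} −
v_{x₂}w_{y₁}`) vanishes on `P` — if and only if `P` is the graph of a symmetric
trace-free matrix `[[a, b], [b, −a]]` with `a² + b² < 1`. -/
theorem splitSLAG_planes_dim_two (P : Submodule ℝ ((Fin 2 → ℝ) × (Fin 2 → ℝ)))
    (hdim : Module.finrank ℝ P = 2) :
    ((∀ v ∈ P, v ≠ 0 → 0 < v.1 ⬝ᵥ v.1 - v.2 ⬝ᵥ v.2) ∧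
      (∀ v ∈ P, ∀ w ∈ P, v.1 ⬝ᵥ w.2 - v.2 ⬝ᵥ w.1 = 0) ∧
      (∀ v ∈ P, ∀ w ∈ P,
        v.1 0 * w.2 1 - v.2 1 * w.1 0 + v.2 0 * w.1 1 - v.1 1 * w.2 0 = 0)) ↔
    (∃ a b : ℝ, a ^ 2 + b ^ 2 < 1 ∧
      ∀ v : (Fin 2 → ℝ) × (Fin 2 → ℝ),
        v ∈ P ↔ v.2 = (!![a, b; b, -a] : Matrix (Fin 2) (Fin 2) ℝ).mulVec v.1) := by
  constructor
  · rintro ⟨hpos, hω, hψ⟩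
    obtain ⟨v, hv, hv1⟩ := exists_mem_fst_eq_of_spacelike (by simpa using hdim) hpos ![1, 0]
    obtain ⟨w, hw, hw1⟩ := exists_mem_fst_eq_of_spacelike (by simpa using hdim) hpos ![0, 1]
    have hsymm : w.2 0 = v.2 1 := by
      have h := hω v hv w hw
      simp [hv1, hw1, dotProduct, Fin.sum_univ_two] at h
      linarith
    have htrace : w.2 1 = -v.2 0 := by
      have h := hψ v hv w hw
      simp [hv1, hw1] at h
      linarith
    refine ⟨v.2 0, v.2 1, ?_, fun u => ⟨fun hu => ?_, fun hu => ?_⟩⟩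
    · have h := hpos v hv fun h0 => by simpa [h0] using congrFun hv1 0
      simp [hv1, dotProduct, Fin.sum_univ_two] at h
      nlinarith
    · have hmem : u - (u.1 0 • v + u.1 1 • w) ∈ P :=
        P.sub_mem hu (P.add_mem (P.smul_mem _ hv) (P.smul_mem _ hw))
      have hzero := eq_zero_of_fst_eq_zero_of_spacelike hpos hmem (by
        ext i
        fin_cases i <;> simp [hv1, hw1])
      rw [sub_eq_zero] at hzero
      have hsnd := congrArg Prod.snd hzero
      ext i
      have h := congrFun hsnd i
      fin_cases i <;> simp [hsymm, htrace, vecHead, vecTail] at h ⊢ <;> linarith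
    · have hcomb : u = u.1 0 • v + u.1 1 • w := by
        ext i
        · fin_cases i <;> simp [hv1, hw1]
        · have h := congrFun hu i
          fin_cases i <;> simp [hsymm, htrace, vecHead, vecTail] at h ⊢ <;> linarith
      rw [hcomb]
      exact P.add_mem (P.smul_mem _ hv) (P.smul_mem _ hw)
  · rintro ⟨a, b, hab, hP⟩
    have hcoord : ∀ v ∈ P, v.2 0 = a * v.1 0 + b * v.1 1 ∧ v.2 1 = b * v.1 0 - a * v.1 1 := by
      intro v hv
      simp [(hP v).1 hv, sub_eq_add_neg, vecHead, vecTail]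
    refine ⟨fun v hv hne => ?_, fun v hv w hw => ?_, fun v hv w hw => ?_⟩
    · obtain ⟨h0, h1⟩ := hcoord v hv
      have hx : 0 < v.1 0 ^ 2 + v.1 1 ^ 2 := by
        by_contra hle
        have hx0 : v.1 0 = 0 := by nlinarith [sq_nonneg (v.1 0), sq_nonneg (v.1 1)]
        have hx1 : v.1 1 = 0 := by nlinarith [sq_nonneg (v.1 0), sq_nonneg (v.1 1)]
        apply hne
        ext i <;> fin_cases i <;> simp [h0, h1, hx0, hx1]
      have hnorm : v.1 ⬝ᵥ v.1 - v.2 ⬝ᵥ v.2 =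
          (1 - (a ^ 2 + b ^ 2)) * (v.1 0 ^ 2 + v.1 1 ^ 2) := by
        simp only [dotProduct, Fin.sum_univ_two, h0, h1]
        ring
      rw [hnorm]
      exact mul_pos (sub_pos.2 hab) hx
    · obtain ⟨hv0, hv1⟩ := hcoord v hv
      obtain ⟨hw0, hw1⟩ := hcoord w hw
      simp only [dotProduct, Fin.sum_univ_two, hv0, hv1, hw0, hw1]
      ring
    · obtain ⟨hv0, hv1⟩ := hcoord v hv
      obtain ⟨hw0, hw1⟩ := hcoord w hw
      rw [hv0, hv1, hw0, hw1]
      ring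
end

section
/- Let u, h : ℝ² → ℝ be C² functions and define φ : ℝ³ → ℝ by φ(x₁, x₂, x₃) = x₃·u(x₁, x₂) + h(x₁, x₂). Then at every point (x₁, x₂, x₃), trace(Hess φ) + det(Hess φ) = x₃·[(1 − u₂²)u₁₁ + 2u₁u₂u₁₂ + (1 − u₁²)u₂₂] + [(1 − u₂²)h₁₁ + 2u₁u₂h₁₂ + (1 − u₁²)h₂₂], where subscripts on u and h denote partial derivatives with respect to x₁ and x₂ evaluated at (x₁, x₂), and Hess φ is the 3×3 matrix of second partial derivatives of φ. -/
open Matrix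

/-- The partial derivative `∂f/∂x_i` of a scalar function on `ℝ^m`. -/
noncomputable def pd {m : ℕ} (i : Fin m) (f : (Fin m → ℝ) → ℝ) : (Fin m → ℝ) → ℝ :=
  fun x => fderiv ℝ f x (Pi.single i 1)

/-- The projection `ℝ³ → ℝ²` onto the first two coordinates. -/
def proj32 (x : Fin 3 → ℝ) : Fin 2 → ℝ := fun i => x i.castSucc

theorem differentiable_pd {m : ℕ} {f : (Fin m → ℝ) → ℝ} (hf : ContDiff ℝ 2 f) (i : Fin m) :
    Differentiable ℝ (pd i f) :=
  ((hf.fderiv_right (m := 1) (by norm_num)).clm_apply contDiff_const).differentiable (by norm_num)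

theorem pd_comm {m : ℕ} {f : (Fin m → ℝ) → ℝ} (hf : ContDiff ℝ 2 f) (i j : Fin m)
    (x : Fin m → ℝ) : pd i (pd j f) x = pd j (pd i f) x := by
  have hd : DifferentiableAt ℝ (fderiv ℝ f) x :=
    (hf.fderiv_right (m := 1) (by norm_num)).differentiable (by norm_num) x
  have key : ∀ i j : Fin m, pd i (pd j f) x =
      fderiv ℝ (fderiv ℝ f) x (Pi.single i 1) (Pi.single j 1) := by
    intro i j
    unfold pd
    rw [fderiv_clm_apply hd (differentiableAt_const _)]
    simp
  rw [key, key]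
  exact (hf.contDiffAt.isSymmSndFDerivAt (by simp)).eq _ _

/-- `proj32` as a continuous linear map. -/
def proj32CLM : (Fin 3 → ℝ) →L[ℝ] (Fin 2 → ℝ) :=
  ContinuousLinearMap.pi fun i => ContinuousLinearMap.proj i.castSucc

theorem fderiv_coord_mul_comp_proj32_add {f g : (Fin 2 → ℝ) → ℝ} (hf : Differentiable ℝ f)
    (hg : Differentiable ℝ g) (y v : Fin 3 → ℝ) :
    fderiv ℝ (fun y : Fin 3 → ℝ => y 2 * f (proj32 y) + g (proj32 y)) y v =
      y 2 * fderiv ℝ f (proj32 y) (proj32 v) + v 2 * f (proj32 y) +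
        fderiv ℝ g (proj32 y) (proj32 v) := by
  have hp : HasFDerivAt proj32 proj32CLM y := proj32CLM.hasFDerivAt
  have hc : HasFDerivAt (fun y : Fin 3 → ℝ => y 2)
      (ContinuousLinearMap.proj (R := ℝ) (φ := fun _ : Fin 3 => ℝ) 2) y :=
    hasFDerivAt_apply 2 y
  have hfd := (hf (proj32 y)).hasFDerivAt.comp y hp
  have hgd := (hg (proj32 y)).hasFDerivAt.comp y hp
  have hv : proj32CLM v = proj32 v := rfl
  have hmain := (hc.mul hfd).add hgd
  refine (DFunLike.congr_fun hmain.fderiv v).trans ?_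
  simp [hv, mul_comm]

theorem proj32_single_castSucc (i : Fin 2) :
    proj32 (Pi.single (i.castSucc : Fin 3) 1) = Pi.single i 1 := by
  ext j
  simp [proj32, Pi.single_apply]

theorem proj32_single_two : proj32 (Pi.single 2 1) = 0 := by
  ext j
  fin_cases j <;> simp [proj32]

theorem pd_castSucc_coord_mul_comp_proj32_add {f g : (Fin 2 → ℝ) → ℝ}
    (hf : Differentiable ℝ f) (hg : Differentiable ℝ g) (i : Fin 2) :
    pd (m := 3) i.castSucc (fun y : Fin 3 → ℝ => y 2 * f (proj32 y) + g (proj32 y)) =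
      fun y => y 2 * pd i f (proj32 y) + pd i g (proj32 y) := by
  funext y
  have h2 : (Pi.single i.castSucc 1 : Fin 3 → ℝ) 2 = 0 := by
    fin_cases i <;> simp
  simp only [pd, fderiv_coord_mul_comp_proj32_add hf hg, proj32_single_castSucc, h2]
  ring

theorem pd_two_coord_mul_comp_proj32_add {f g : (Fin 2 → ℝ) → ℝ}
    (hf : Differentiable ℝ f) (hg : Differentiable ℝ g) :
    pd 2 (fun y : Fin 3 → ℝ => y 2 * f (proj32 y) + g (proj32 y)) = fun y => f (proj32 y) := by
  funext y
  simp [pd, fderiv_coord_mul_comp_proj32_add hf hg, proj32_single_two]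

theorem pd_castSucc_comp_proj32 {f : (Fin 2 → ℝ) → ℝ} (hf : Differentiable ℝ f) (i : Fin 2) :
    pd (m := 3) i.castSucc (fun y : Fin 3 → ℝ => f (proj32 y)) = fun y => pd i f (proj32 y) := by
  have h0 : pd i (fun _ => (0 : ℝ)) = fun _ => 0 := by
    funext y
    simp [pd]
  simpa [h0] using pd_castSucc_coord_mul_comp_proj32_add (f := fun _ => 0)
    (differentiable_const 0) hf i

theorem pd_two_comp_proj32 {f : (Fin 2 → ℝ) → ℝ} (hf : Differentiable ℝ f) :
    pd 2 (fun y : Fin 3 → ℝ => f (proj32 y)) = fun _ => 0 := by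
  simpa using pd_two_coord_mul_comp_proj32_add (f := fun _ => 0) (differentiable_const 0) hf

/-- The computation proving **Theorem C.2** of Harvey–Lawson, "Split Special Lagrangian
Geometry": for `φ(x₁,x₂,x₃) = x₃·u(x₁,x₂) + h(x₁,x₂)` with `u, h` of class `C²`,
`trace(Hess φ) + det(Hess φ) = x₃·[(1−u₂²)u₁₁ + 2u₁u₂u₁₂ + (1−u₁²)u₂₂]
  + [(1−u₂²)h₁₁ + 2u₁u₂h₁₂ + (1−u₁²)h₂₂]`. -/
theorem twisted_normal_bundle_potential_identity (u h : (Fin 2 → ℝ) → ℝ)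
    (hu : ContDiff ℝ 2 u) (hh : ContDiff ℝ 2 h) :
    ∀ x : Fin 3 → ℝ,
      Matrix.trace (Matrix.of fun i j : Fin 3 =>
          pd i (pd j (fun y => y 2 * u (proj32 y) + h (proj32 y))) x) +
        (Matrix.of fun i j : Fin 3 =>
          pd i (pd j (fun y => y 2 * u (proj32 y) + h (proj32 y))) x).det =
      x 2 * ((1 - pd 1 u (proj32 x) ^ 2) * pd 0 (pd 0 u) (proj32 x) +
          2 * pd 0 u (proj32 x) * pd 1 u (proj32 x) * pd 0 (pd 1 u) (proj32 x) +
          (1 - pd 0 u (proj32 x) ^ 2) * pd 1 (pd 1 u) (proj32 x)) +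
        ((1 - pd 1 u (proj32 x) ^ 2) * pd 0 (pd 0 h) (proj32 x) +
          2 * pd 0 u (proj32 x) * pd 1 u (proj32 x) * pd 0 (pd 1 h) (proj32 x) +
          (1 - pd 0 u (proj32 x) ^ 2) * pd 1 (pd 1 h) (proj32 x)) := by
  intro x
  have du : Differentiable ℝ u := hu.differentiable (by norm_num)
  have dh : Differentiable ℝ h := hh.differentiable (by norm_num)
  have first_zero := pd_castSucc_coord_mul_comp_proj32_add du dh 0
  have first_one := pd_castSucc_coord_mul_comp_proj32_add du dh 1
  have second_zero (i : Fin 2) := pd_castSucc_coord_mul_comp_proj32_add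
    (differentiable_pd hu i) (differentiable_pd hh i) 0
  have second_one (i : Fin 2) := pd_castSucc_coord_mul_comp_proj32_add
    (differentiable_pd hu i) (differentiable_pd hh i) 1
  have mixed (i : Fin 2) := pd_two_coord_mul_comp_proj32_add
    (differentiable_pd hu i) (differentiable_pd hh i)
  have mixed_zero := pd_castSucc_comp_proj32 du 0
  have mixed_one := pd_castSucc_comp_proj32 du 1
  simp only [Fin.castSucc_zero] at first_zero second_zero mixed_zero
  simp only [Fin.castSucc_one] at first_one second_one mixed_one
  simp only [Matrix.trace_fin_three, Matrix.det_fin_three, Matrix.of_apply, first_zero, first_one,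
    second_zero, second_one, mixed, mixed_zero, mixed_one,
    pd_two_coord_mul_comp_proj32_add du dh, pd_two_comp_proj32 du,
    pd_comm hu 1 0, pd_comm hh 1 0]
  ring
end
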